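/- arXiv:1806.03216 — 8 statements merged into one kernel-verified Lean document; each statement's English description precedes it below -/
import Mathlib

section
/- Let q₁ and q₂ be quadratic forms on the 2-dimensional rational vector space Fin 2 → ℚ whose associated bilinear forms are nondegenerate, and let p be a prime number. Suppose that for every prime ℓ ≠ p the base-changed quadratic forms q₁ ⊗ ℚ_ℓ and q₂ ⊗ ℚ_ℓ on ℚ_ℓ ⊗[ℚ] (Fin 2 → ℚ) are equivalent (isometric). Then q₁ is positive definite if and only if one of the following two cases holds: (1) q₁ ⊗ ℚ_p and q₂ ⊗ ℚ_p are equivalent and q₂ is positive definite; (2) q₁ ⊗ ℚ_p and q₂ ⊗ ℚ_p are not equivalent and q₂ is negative definite. -/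
open QuadraticMap

open scoped TensorProduct in
theorem baseChange_equivalent_weightedSumSquares (K : Type*) [Field K] [Algebra ℚ K]
    {q : QuadraticForm ℚ (Fin 2 → ℚ)} {w : Fin 2 → ℚ}
    (h : q.Equivalent (weightedSumSquares ℚ w)) :
    (q.baseChange K).Equivalent (weightedSumSquares K fun i => algebraMap ℚ K (w i)) := by
  obtain ⟨f⟩ := h
  let e : K ⊗[ℚ] (Fin 2 → ℚ) ≃ₗ[K] (Fin 2 → K) :=
    (f.toLinearEquiv.baseChange ℚ K _ _).trans (TensorProduct.piScalarRight ℚ K K (Fin 2))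
  have key : q.baseChange K =
      (weightedSumSquares K fun i => algebraMap ℚ K (w i)).comp (e : _ →ₗ[K] _) := by
    apply baseChange_ext
    intro m
    have := f.map_app m
    simp only [weightedSumSquares_apply, Fin.sum_univ_two] at this
    simp only [QuadraticForm.baseChange_tmul, ← this]
    simp [e, weightedSumSquares_apply, Algebra.smul_def, -eq_ratCast]
  exact ⟨⟨e, fun m => by rw [key]; rfl⟩⟩

theorem exists_equivalent_weightedSumSquares {q : QuadraticForm ℚ (Fin 2 → ℚ)}
    (hq : (associated (R := ℚ) q).SeparatingLeft) :
    ∃ a b : ℚ, a ≠ 0 ∧ b ≠ 0 ∧ q.Equivalent (weightedSumSquares ℚ ![a, b]) := by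
  obtain ⟨w, hw⟩ := QuadraticForm.equivalent_weightedSumSquares_units_of_nondegenerate' q hq
  have h2 : Module.finrank ℚ (Fin 2 → ℚ) = 2 := by simp
  generalize Module.finrank ℚ (Fin 2 → ℚ) = n at *
  subst h2
  refine ⟨w 0, w 1, (w 0).ne_zero, (w 1).ne_zero, ?_⟩
  have : weightedSumSquares ℚ ![(w 0 : ℚ), (w 1 : ℚ)] = weightedSumSquares ℚ w := by
    refine QuadraticMap.ext fun v => ?_
    simp [weightedSumSquares_apply, Units.smul_def]
  rw [this]
  exact hw

theorem weightedSumSquares_equivalent_of_represents {K : Type*} [Field K] {a b c d x y s : K}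
    (hc : c ≠ 0) (hs : s ≠ 0) (hxy : a * x ^ 2 + b * y ^ 2 = c)
    (hsd : d = a * b * s ^ 2 * c) :
    (weightedSumSquares K ![c, d]).Equivalent (weightedSumSquares K ![a, b]) := by
  have hdet : LinearMap.det (Matrix.toLin' !![x, -(b * y * s); y, a * x * s]) ≠ 0 := by
    rw [LinearMap.det_toLin', Matrix.det_fin_two_of]
    have : x * (a * x * s) - -(b * y * s) * y = s * c := by rw [← hxy]; ring
    rw [this]
    exact mul_ne_zero hs hc
  refine ⟨⟨LinearMap.equivOfDetNeZero _ hdet, fun v => ?_⟩⟩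
  rw [weightedSumSquares_apply, weightedSumSquares_apply]
  simp [Matrix.mulVec, dotProduct]
  rw [hsd, ← hxy]
  ring

theorem weightedSumSquares_equivalent_iff {K : Type*} [Field K] [CharZero K] {a b c d : K}
    (hc : c ≠ 0) (hd : d ≠ 0) :
    (weightedSumSquares K ![a, b]).Equivalent (weightedSumSquares K ![c, d]) ↔
      (∃ t, c * d = a * b * t ^ 2) ∧ ∃ x y, a * x ^ 2 + b * y ^ 2 = c := by
  constructor
  · rintro ⟨f⟩
    have hf : ∀ v, a * (f.symm v 0) ^ 2 + b * (f.symm v 1) ^ 2 = c * v 0 ^ 2 + d * v 1 ^ 2 := by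
      intro v
      have := f.symm.map_app v
      rw [weightedSumSquares_apply, weightedSumSquares_apply] at this
      simp only [Fin.sum_univ_two, smul_eq_mul, Matrix.cons_val_zero, Matrix.cons_val_one] at this
      linear_combination this
    have h0 := hf ![1, 0]
    have h1 := hf ![0, 1]
    have h2 := hf (![1, 0] + ![0, 1])
    have hadd : f.symm (![1, 0] + ![0, 1]) = f.symm ![1, 0] + f.symm ![0, 1] :=
      map_add f.symm.toLinearEquiv _ _
    rw [hadd] at h2
    generalize f.symm ![1, 0] = u at *
    generalize f.symm ![0, 1] = v at *
    simp at h0 h1 h2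
    have h01 : a * u 0 * v 0 + b * u 1 * v 1 = 0 := by
      have : (2 : K) ≠ 0 := two_ne_zero
      apply mul_left_cancel₀ this
      linear_combination h2 - h0 - h1
    refine ⟨⟨u 0 * v 1 - u 1 * v 0, ?_⟩, u 0, u 1, h0⟩
    rw [← h0, ← h1]
    linear_combination (a * u 0 * v 0 + b * u 1 * v 1) * h01
  · rintro ⟨⟨t, ht⟩, x, y, hxy⟩
    have ht0 : t ≠ 0 := by
      rintro rfl
      exact mul_ne_zero hc hd (by simpa using ht)
    refine .symm (weightedSumSquares_equivalent_of_represents hc (div_ne_zero ht0 hc) hxy ?_)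
    field_simp
    linear_combination ht

theorem posDef_iff_of_equivalent {q : QuadraticForm ℚ (Fin 2 → ℚ)} {a b : ℚ}
    (h : q.Equivalent (weightedSumSquares ℚ ![a, b])) : q.PosDef ↔ 0 < a ∧ 0 < b := by
  obtain ⟨f⟩ := h
  have hf : ∀ v, q (f.symm v) = a * v 0 ^ 2 + b * v 1 ^ 2 := by
    intro v
    rw [f.symm.map_app v]
    simp [weightedSumSquares_apply, pow_two]
  have hf0 : ∀ v, v ≠ 0 → f.symm v ≠ 0 := fun v hv => f.symm.toLinearEquiv.map_ne_zero_iff.2 hv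
  constructor
  · intro h
    have h0 := h _ (hf0 ![1, 0] (by simp))
    have h1 := h _ (hf0 ![0, 1] (by simp))
    rw [hf] at h0 h1
    simpa using And.intro h0 h1
  · rintro ⟨ha, hb⟩ v hv
    have h0 : f v ≠ 0 := f.toLinearEquiv.map_ne_zero_iff.2 hv
    have := hf (f v)
    rw [f.symm_apply_apply] at this
    rw [this]
    by_cases h : f v 0 = 0
    · have : f v 1 ≠ 0 := fun h' => h0 (by ext i; fin_cases i <;> simp [h, h'])
      positivity
    · positivity

theorem neg_definite_iff_of_equivalent {q : QuadraticForm ℚ (Fin 2 → ℚ)} {a b : ℚ}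
    (h : q.Equivalent (weightedSumSquares ℚ ![a, b])) :
    (∀ v, v ≠ 0 → q v < 0) ↔ a < 0 ∧ b < 0 := by
  have h' : (-q).Equivalent (weightedSumSquares ℚ ![-a, -b]) := by
    obtain ⟨f⟩ := h
    refine ⟨⟨f.toLinearEquiv, fun m => ?_⟩⟩
    have := f.map_app m
    rw [weightedSumSquares_apply] at this ⊢
    simp at this ⊢
    linarith
  simpa [PosDef] using posDef_iff_of_equivalent h'

/-- The ternary quadratic form `a x² + b y² + c z²` has a nontrivial zero. -/
def IsotropicDiag {K : Type*} [Field K] (a b c : K) : Prop :=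
  ∃ x y z : K, (x ≠ 0 ∨ y ≠ 0 ∨ z ≠ 0) ∧ a * x ^ 2 + b * y ^ 2 + c * z ^ 2 = 0

namespace IsotropicDiag

variable {K : Type*} [Field K] {a b c t : K}

theorem swap (h : IsotropicDiag a b c) : IsotropicDiag b a c := by
  obtain ⟨x, y, z, h0, h⟩ := h
  exact ⟨y, x, z, by tauto, by linear_combination h⟩

theorem rotate (h : IsotropicDiag a b c) : IsotropicDiag b c a := by
  obtain ⟨x, y, z, h0, h⟩ := h
  exact ⟨y, z, x, by tauto, by linear_combination h⟩

theorem mul_sq_iff (ht : t ≠ 0) : IsotropicDiag (a * t ^ 2) b c ↔ IsotropicDiag a b c := by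
  constructor
  · rintro ⟨x, y, z, h0, h⟩
    exact ⟨t * x, y, z, by simpa [ht] using h0, by linear_combination h⟩
  · rintro ⟨x, y, z, h0, h⟩
    exact ⟨x / t, y, z, by simpa [ht] using h0, by field_simp; linear_combination h⟩

theorem mul_mul_iff (ht : t ≠ 0) :
    IsotropicDiag (t * a) (t * b) c ↔ IsotropicDiag a b (t * c) := by
  constructor
  · rintro ⟨x, y, z, h0, h⟩
    exact ⟨x, y, z / t, by simpa [ht] using h0, by
      field_simp; linear_combination h⟩
  · rintro ⟨x, y, z, h0, h⟩
    exact ⟨x, y, t * z, by simpa [ht] using h0, by linear_combination t * h⟩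

theorem neg_iff [CharZero K] (ha : a ≠ 0) (hb : b ≠ 0) :
    IsotropicDiag a b (-c) ↔ ∃ x y, a * x ^ 2 + b * y ^ 2 = c := by
  constructor
  · rintro ⟨x, y, z, h0, h⟩
    by_cases hz : z = 0
    · subst hz
      have hx : x ≠ 0 := by
        rintro rfl
        have : y = 0 := by simpa [hb] using h
        simp_all
      have hy : y ≠ 0 := by
        rintro rfl
        simp_all
      refine ⟨(c / a + 1) / 2, (c / a - 1) / 2 * (y / x), ?_⟩
      have hb' : b = -a * x ^ 2 / y ^ 2 := by field_simp; linear_combination h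
      rw [hb']
      field_simp
      ring
    · exact ⟨x / z, y / z, by field_simp; linear_combination h⟩
  · rintro ⟨x, y, h⟩
    exact ⟨x, y, 1, by simp, by linear_combination h⟩

end IsotropicDiag

section Local

variable {p : ℕ} [Fact p.Prime]

theorem PadicInt.exists_mul_sq_add_eq_zero {a m t : ℤ_[p]}
    (h : ‖a * t ^ 2 + m‖ < ‖2 * a * t‖ ^ 2) : ∃ s : ℤ_[p], a * s ^ 2 + m = 0 := by
  open Polynomial in
  obtain ⟨z, hz, -⟩ := hensels_lemma (F := (C a * X ^ 2 + C m : ℤ_[p][X])) (a := t) (by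
    simp only [map_add, map_mul, aeval_C, aeval_X, map_pow, Algebra.algebraMap_self, RingHom.id_apply,
      derivative_mul, derivative_C, derivative_X_pow]
    convert h using 3
    simp
    ring)
  exact ⟨z, by simpa using hz⟩

theorem Padic.exists_mul_sq_add_eq_zero_of_dvd (hp : p ≠ 2) {a m t : ℤ} (ha : ¬ (p : ℤ) ∣ a)
    (ht : ¬ (p : ℤ) ∣ t) (h : (p : ℤ) ∣ a * t ^ 2 + m) : ∃ s : ℚ_[p], a * s ^ 2 + m = 0 := by
  have hp' : Prime (p : ℤ) := Nat.prime_iff_prime_int.1 Fact.out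
  have h2 : ¬ (p : ℤ) ∣ 2 * a * t := by
    rw [hp'.dvd_mul, hp'.dvd_mul]
    have : ¬ (p : ℤ) ∣ 2 := by
      intro h
      have : p ∣ 2 := by exact_mod_cast h
      exact hp ((Nat.prime_dvd_prime_iff_eq Fact.out Nat.prime_two).1 this)
    tauto
  have h2' : ‖((2 * a * t : ℤ) : ℤ_[p])‖ = 1 := by
    refine le_antisymm (PadicInt.norm_le_one _) (not_lt.1 fun h => h2 ?_)
    exact (PadicInt.norm_int_lt_one_iff_dvd _).1 h
  have h1 : ‖((a * t ^ 2 + m : ℤ) : ℤ_[p])‖ < 1 := (PadicInt.norm_int_lt_one_iff_dvd _).2 h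
  obtain ⟨s, hs⟩ := PadicInt.exists_mul_sq_add_eq_zero (p := p) (a := a) (m := m) (t := t) (by
    push_cast at h1 h2'
    rw [h2']; simpa using h1)
  exact ⟨s, by exact_mod_cast congrArg (fun x : ℤ_[p] => (x : ℚ_[p])) hs⟩

theorem Padic.exists_mul_sq_add_eq_zero_two {a m : ℤ} (ha : ¬ (2 : ℤ) ∣ a)
    (h : (8 : ℤ) ∣ a + m) : ∃ s : ℚ_[2], a * s ^ 2 + m = 0 := by
  have h2' : ‖((a : ℤ) : ℤ_[2])‖ = 1 := by
    refine le_antisymm (PadicInt.norm_le_one _) (not_lt.1 fun h => ha ?_)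
    exact_mod_cast (PadicInt.norm_int_lt_one_iff_dvd _).1 h
  have h1 : ‖((a + m : ℤ) : ℤ_[2])‖ ≤ 2 ^ (-3 : ℤ) := by
    have := (PadicInt.norm_int_le_pow_iff_dvd (p := 2) (k := a + m) (n := 3)).2 (by simpa using h)
    simpa using this
  obtain ⟨s, hs⟩ := PadicInt.exists_mul_sq_add_eq_zero (p := 2) (a := a) (m := m) (t := 1) (by
    push_cast at h1
    have h2 : ‖(2 : ℤ_[2])‖ = 2⁻¹ := by simpa using PadicInt.norm_p (p := 2)
    simp only [norm_mul, h2', h2, one_pow, mul_one]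
    refine h1.trans_lt ?_
    norm_num)
  exact ⟨s, by exact_mod_cast congrArg (fun x : ℤ_[2] => (x : ℚ_[2])) hs⟩

theorem IsotropicDiag.exists_int_of_norm_le {a b c : ℤ} {x y z : ℚ_[p]} (hx : x ≠ 0)
    (hy : ‖y‖ ≤ ‖x‖) (hz : ‖z‖ ≤ ‖x‖) (h : a * x ^ 2 + b * y ^ 2 + c * z ^ 2 = 0) (n : ℕ) :
    ∃ y z : ℤ, (p ^ n : ℤ) ∣ a * 1 ^ 2 + b * y ^ 2 + c * z ^ 2 := by
  have hint : ∀ {w : ℚ_[p]}, ‖w‖ ≤ ‖x‖ → ‖w / x‖ ≤ 1 := fun hw => by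
    rw [norm_div]; exact div_le_one_of_le₀ hw (norm_nonneg _)
  obtain ⟨u, hu⟩ : ∃ u : ℤ_[p], (u : ℚ_[p]) = y / x := ⟨⟨_, hint hy⟩, rfl⟩
  obtain ⟨v, hv⟩ : ∃ v : ℤ_[p], (v : ℚ_[p]) = z / x := ⟨⟨_, hint hz⟩, rfl⟩
  have huv : (a : ℤ_[p]) + b * u ^ 2 + c * v ^ 2 = 0 := by
    apply Subtype.ext
    push_cast
    rw [hu, hv]
    field_simp
    linear_combination h
  refine ⟨(PadicInt.toZModPow n u).val, (PadicInt.toZModPow n v).val, ?_⟩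
  have := congrArg (PadicInt.toZModPow n) huv
  have hcast : (p ^ n : ℤ) = ((p ^ n : ℕ) : ℤ) := by push_cast; rfl
  rw [hcast, ← ZMod.intCast_zmod_eq_zero_iff_dvd]
  simpa using this

theorem IsotropicDiag.exists_int {a b c : ℤ} (h : IsotropicDiag (a : ℚ_[p]) b c) (n : ℕ) :
    ∃ x y z : ℤ, ¬ ((p : ℤ) ∣ x ∧ (p : ℤ) ∣ y ∧ (p : ℤ) ∣ z) ∧
      (p ^ n : ℤ) ∣ a * x ^ 2 + b * y ^ 2 + c * z ^ 2 := by
  have h1 : ¬ (p : ℤ) ∣ 1 := (Nat.prime_iff_prime_int.1 (Fact.out : p.Prime)).not_dvd_one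
  obtain ⟨x, y, z, h0, h⟩ := h
  have hmax : (x ≠ 0 ∧ ‖y‖ ≤ ‖x‖ ∧ ‖z‖ ≤ ‖x‖) ∨ (y ≠ 0 ∧ ‖x‖ ≤ ‖y‖ ∧ ‖z‖ ≤ ‖y‖) ∨
      (z ≠ 0 ∧ ‖x‖ ≤ ‖z‖ ∧ ‖y‖ ≤ ‖z‖) := by
    simp only [← norm_pos_iff] at h0 ⊢
    have := norm_nonneg x
    have := norm_nonneg y
    have := norm_nonneg z
    grind
  rcases hmax with ⟨h0, h2, h3⟩ | ⟨h0, h2, h3⟩ | ⟨h0, h2, h3⟩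
  · obtain ⟨y, z, h⟩ := IsotropicDiag.exists_int_of_norm_le h0 h2 h3 h n
    exact ⟨1, y, z, by tauto, h⟩
  · obtain ⟨x, z, h⟩ := IsotropicDiag.exists_int_of_norm_le (a := b) (b := a) (c := c) h0 h2 h3
      (by linear_combination h) n
    exact ⟨x, 1, z, by tauto, by convert h using 1; ring⟩
  · obtain ⟨x, y, h⟩ := IsotropicDiag.exists_int_of_norm_le (a := c) (b := a) (c := b) h0 h2 h3
      (by linear_combination h) n
    exact ⟨x, y, 1, by tauto, by convert h using 1; ring⟩

theorem isotropicDiag_of_not_dvd (hp : p ≠ 2) {a b c : ℤ} (ha : ¬ (p : ℤ) ∣ a)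
    (hb : ¬ (p : ℤ) ∣ b) (hc : ¬ (p : ℤ) ∣ c) : IsotropicDiag (a : ℚ_[p]) b c := by
  have hp' : Prime (p : ℤ) := Nat.prime_iff_prime_int.1 Fact.out
  obtain ⟨x, y, hxy⟩ : ∃ x y : ℤ, (p : ℤ) ∣ a * x ^ 2 + b * y ^ 2 + c := by
    open Polynomial in
    have ha' : (a : ZMod p) ≠ 0 := by rwa [Ne, ZMod.intCast_zmod_eq_zero_iff_dvd]
    have hb' : (b : ZMod p) ≠ 0 := by rwa [Ne, ZMod.intCast_zmod_eq_zero_iff_dvd]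
    obtain ⟨x, y, h⟩ := FiniteField.exists_root_sum_quadratic (R := ZMod p)
      (f := C (a : ZMod p) * X ^ 2 + C 0 * X + C 0)
      (g := C (b : ZMod p) * X ^ 2 + C 0 * X + C (c : ZMod p)) (degree_quadratic ha')
      (degree_quadratic hb')
      (by rw [ZMod.card]; exact (Fact.out : p.Prime).eq_two_or_odd.resolve_left hp)
    refine ⟨x.val, y.val, ?_⟩
    rw [← ZMod.intCast_zmod_eq_zero_iff_dvd]
    simpa [add_assoc] using h
  by_cases hx : (p : ℤ) ∣ x
  · have hy : ¬ (p : ℤ) ∣ y := by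
      intro hy
      apply hc
      have := dvd_add ((hx.mul_left (a * x))) (hy.mul_left (b * y))
      rw [← Int.dvd_add_right this]
      convert hxy using 1
      ring
    obtain ⟨s, hs⟩ := Padic.exists_mul_sq_add_eq_zero_of_dvd hp hb hy (m := a * x ^ 2 + c)
      (by convert hxy using 1; ring)
    exact ⟨x, s, 1, by simp, by push_cast at hs; linear_combination hs⟩
  · obtain ⟨s, hs⟩ := Padic.exists_mul_sq_add_eq_zero_of_dvd hp ha hx (m := b * y ^ 2 + c)
      (by convert hxy using 1; ring)
    exact ⟨s, y, 1, by simp, by push_cast at hs; linear_combination hs⟩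

theorem isotropicDiag_iff_of_dvd (hp : p ≠ 2) {a b c : ℤ} (ha : (p : ℤ) ∣ a)
    (ha' : ¬ (p ^ 2 : ℤ) ∣ a) (hb : ¬ (p : ℤ) ∣ b) (hc : ¬ (p : ℤ) ∣ c) :
    IsotropicDiag (a : ℚ_[p]) b c ↔ jacobiSym (-(b * c)) p = 1 := by
  have hp' : Prime (p : ℤ) := Nat.prime_iff_prime_int.1 Fact.out
  have hbc : ¬ (p : ℤ) ∣ -(b * c) := by rw [dvd_neg, hp'.dvd_mul]; tauto
  have hbc' : ((-(b * c) : ℤ) : ZMod p) ≠ 0 := by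
    rwa [Ne, ZMod.intCast_zmod_eq_zero_iff_dvd]
  rw [← jacobiSym.legendreSym.to_jacobiSym, legendreSym.eq_one_iff p hbc']
  constructor
  · intro h
    obtain ⟨x, y, z, h0, h⟩ := h.exists_int 2
    obtain ⟨d, rfl⟩ := ha
    have hd : ¬ (p : ℤ) ∣ d := fun hd => ha' (by rw [pow_two]; exact mul_dvd_mul_left _ hd)
    have h1 : (p : ℤ) ∣ b * y ^ 2 + c * z ^ 2 := by
      have h2 := (dvd_pow_self (p : ℤ) two_ne_zero).trans h
      rw [add_assoc] at h2
      exact (Int.dvd_add_right ((dvd_mul_right _ d).mul_right _)).1 h2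
    have hz : ¬ (p : ℤ) ∣ z := by
      intro hz
      have hy : (p : ℤ) ∣ y := by
        have := (Int.dvd_add_left ((dvd_pow hz two_ne_zero).mul_left c)).1 h1
        exact hp'.dvd_of_dvd_pow ((hp'.dvd_or_dvd this).resolve_left hb)
      refine h0 ⟨?_, hy, hz⟩
      have h2 := dvd_add ((pow_dvd_pow_of_dvd hy 2).mul_left b)
        ((pow_dvd_pow_of_dvd hz 2).mul_left c)
      rw [add_assoc] at h
      have h3 := (Int.dvd_add_left h2).1 h
      rw [pow_two, mul_assoc] at h3
      have h4 := Int.dvd_of_mul_dvd_mul_left hp'.ne_zero h3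
      exact hp'.dvd_of_dvd_pow ((hp'.dvd_or_dvd h4).resolve_left hd)
    have hz' : (z : ZMod p) ≠ 0 := by rwa [Ne, ZMod.intCast_zmod_eq_zero_iff_dvd]
    have h1' := (ZMod.intCast_zmod_eq_zero_iff_dvd _ p).2 h1
    push_cast at h1' ⊢
    refine ⟨b * y / z, ?_⟩
    field_simp
    linear_combination (-b : ZMod p) * h1'
  · rintro ⟨r, hr⟩
    have hr' : (p : ℤ) ∣ 1 * (r.val : ℤ) ^ 2 + b * c := by
      rw [← ZMod.intCast_zmod_eq_zero_iff_dvd]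
      push_cast at hr ⊢
      rw [ZMod.natCast_val, ZMod.cast_id]
      linear_combination -hr
    have hr0 : ¬ (p : ℤ) ∣ (r.val : ℤ) := by
      intro h
      rw [← ZMod.intCast_zmod_eq_zero_iff_dvd] at h
      rw [Int.cast_natCast, ZMod.natCast_val, ZMod.cast_id] at h
      rw [h, mul_zero] at hr
      exact hbc' hr
    obtain ⟨s, hs⟩ := Padic.exists_mul_sq_add_eq_zero_of_dvd hp hp'.not_dvd_one hr0 hr'
    refine ⟨0, s, b, Or.inr (Or.inr ?_), ?_⟩
    · rw [Int.cast_ne_zero]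
      rintro rfl
      simp at hb
    · push_cast at hs
      linear_combination (b : ℚ_[p]) * hs

end Local

theorem isotropicDiag_two_of_dvd {a b c : ℤ} (ha : ¬ 2 ∣ a) (h : 8 ∣ a + b ∨ 8 ∣ a + b + c ∨ 8 ∣ a + b + 4 * c) : IsotropicDiag (a : ℚ_[2]) b c := by
  rcases h with h | h | h
  · obtain ⟨s, hs⟩ := Padic.exists_mul_sq_add_eq_zero_two ha h
    exact ⟨s, 1, 0, by simp, by linear_combination hs⟩
  · rw [add_assoc] at h
    obtain ⟨s, hs⟩ := Padic.exists_mul_sq_add_eq_zero_two ha h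
    exact ⟨s, 1, 1, by simp, by push_cast at hs; linear_combination hs⟩
  · rw [add_assoc] at h
    obtain ⟨s, hs⟩ := Padic.exists_mul_sq_add_eq_zero_two ha h
    exact ⟨s, 1, 2, by simp, by push_cast at hs; linear_combination hs⟩

theorem Int.sq_emod_eight (x : ℤ) :
    2 ∣ x ∧ (x ^ 2 % 8 = 0 ∨ x ^ 2 % 8 = 4) ∨ ¬ 2 ∣ x ∧ x ^ 2 % 8 = 1 := by
  have : x % 8 < 8 := Int.emod_lt_of_pos _ (by norm_num)
  have : 0 ≤ x % 8 := Int.emod_nonneg _ (by norm_num)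
  rw [pow_two, Int.mul_emod, Int.dvd_iff_emod_eq_zero, ← Int.emod_emod_of_dvd x (by norm_num : (2 : ℤ) ∣ 8)]
  generalize x % 8 = r at *
  interval_cases r <;> simp

theorem isotropicDiag_two_iff_of_odd {a b c : ℤ} (ha : ¬ 2 ∣ a) (hb : ¬ 2 ∣ b) (hc : ¬ 2 ∣ c) :
    IsotropicDiag (a : ℚ_[2]) b c ↔ 4 ∣ a + b ∨ 4 ∣ b + c ∨ 4 ∣ c + a := by
  constructor
  · intro h
    obtain ⟨x, y, z, h0, h⟩ := h.exists_int 3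
    have hx := Int.sq_emod_eight x
    have hy := Int.sq_emod_eight y
    have hz := Int.sq_emod_eight z
    have hmul : ∀ {a X r : ℤ}, X % 8 = r → (a * X) % 8 = (a * r) % 8 := by
      rintro a X r rfl
      simp [Int.mul_emod]
    norm_num at h0 h
    rcases hx with ⟨hx2, hx | hx⟩ | ⟨hx2, hx⟩ <;> rcases hy with ⟨hy2, hy | hy⟩ | ⟨hy2, hy⟩ <;>
      rcases hz with ⟨hz2, hz | hz⟩ | ⟨hz2, hz⟩ <;>
    · have hx' := hmul (a := a) hx
      have hy' := hmul (a := b) hy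
      have hz' := hmul (a := c) hz
      clear hmul
      generalize a * x ^ 2 = X at *
      generalize b * y ^ 2 = Y at *
      generalize c * z ^ 2 = Z at *
      omega
  · have h4 : ∀ {a b c : ℤ}, ¬ 2 ∣ c → 4 ∣ a + b → 8 ∣ a + b ∨ 8 ∣ a + b + c ∨ 8 ∣ a + b + 4 * c := by
      intros; omega
    rintro (h | h | h)
    · exact isotropicDiag_two_of_dvd ha (h4 hc h)
    · exact (isotropicDiag_two_of_dvd hb (h4 ha h)).rotate.rotate
    · exact (isotropicDiag_two_of_dvd hc (h4 hb h)).rotate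

theorem isotropicDiag_two_iff_of_even {a b c : ℤ} (ha : ¬ 2 ∣ a) (hb : ¬ 2 ∣ b) (hc : 2 ∣ c)
    (hc' : ¬ 4 ∣ c) :
    IsotropicDiag (a : ℚ_[2]) b c ↔ 8 ∣ a + b ∨ 8 ∣ a + b + c := by
  constructor
  · intro h
    obtain ⟨x, y, z, h0, h⟩ := h.exists_int 3
    have hx := Int.sq_emod_eight x
    have hy := Int.sq_emod_eight y
    have hz := Int.sq_emod_eight z
    have hmul : ∀ {a X r : ℤ}, X % 8 = r → (a * X) % 8 = (a * r) % 8 := by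
      rintro a X r rfl
      simp [Int.mul_emod]
    norm_num at h0 h
    rcases hx with ⟨hx2, hx | hx⟩ | ⟨hx2, hx⟩ <;> rcases hy with ⟨hy2, hy | hy⟩ | ⟨hy2, hy⟩ <;>
      rcases hz with ⟨hz2, hz | hz⟩ | ⟨hz2, hz⟩ <;>
    · have hx' := hmul (a := a) hx
      have hy' := hmul (a := b) hy
      have hz' := hmul (a := c) hz
      clear hmul
      generalize a * x ^ 2 = X at *
      generalize b * y ^ 2 = Y at *
      generalize c * z ^ 2 = Z at *
      omega
  · exact fun h => isotropicDiag_two_of_dvd ha (by tauto)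

section JacobiSymbols

open NumberTheorySymbols

theorem jacobiSym.mul_swap {m n : ℕ} (hm : Odd m) (hn : Odd n) (h : m.Coprime n) :
    J(m | n) * J(n | m) = if m % 4 = 3 ∧ n % 4 = 3 then -1 else 1 := by
  rw [← jacobiSym.quadratic_reciprocity_if (Nat.odd_iff.1 hm) (Nat.odd_iff.1 hn)]
  have : J(n | m) ^ 2 = 1 := jacobiSym.sq_one (by simpa using h.symm)
  split_ifs
  · linear_combination -this
  · linear_combination this

theorem jacobiSym.at_neg_one_eq_ite {n : ℕ} (hn : Odd n) :
    J(-1 | n) = if n % 4 = 1 then 1 else -1 := by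
  rw [jacobiSym.at_neg_one hn, ZMod.χ₄_nat_eq_if_mod_four, if_neg (by rw [Nat.odd_iff.1 hn]; simp)]

theorem jacobiSym.at_two_eq_ite {n : ℕ} (hn : Odd n) :
    J(2 | n) = if n % 8 = 1 ∨ n % 8 = 7 then 1 else -1 := by
  rw [jacobiSym.at_two hn, ZMod.χ₈_nat_eq_if_mod_eight, if_neg (by rw [Nat.odd_iff.1 hn]; simp)]

theorem Int.exists_sign_mul_natAbs {a : ℤ} (ha : a ≠ 0) :
    ∃ s : ℤ, (s = 1 ∧ 0 < a ∨ s = -1 ∧ a < 0) ∧ a = s * a.natAbs := by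
  rcases lt_or_gt_of_ne ha with h | h
  · exact ⟨-1, by simp [h], by omega⟩
  · exact ⟨1, by simp [h], by omega⟩

theorem Int.exists_eq_mul_mod_add {a s : ℤ} {n : ℕ} (h : a = s * n) (m : ℕ) :
    ∃ k, a = s * (n % m : ℕ) + m * k := by
  refine ⟨s * (n / m : ℕ), ?_⟩
  rw [h]
  nth_rewrite 1 [← Nat.mod_add_div n m]
  push_cast
  ring

theorem jacobiSym.product_eq {k s t u : ℤ} {A B C : ℕ} (hA : Odd A) (hB : Odd B) (hC : Odd C)
    (hAB : A.Coprime B) (hBC : B.Coprime C) (hCA : C.Coprime A) :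
    J(-((t * B) * (k * (u * C))) | A) * J(-((s * A) * (k * (u * C))) | B) *
        J(-((s * A) * (t * B)) | C) =
      J(k | A) * J(k | B) * (J(-1 | A) * J(t | A) * J(u | A)) * (J(-1 | B) * J(s | B) * J(u | B)) *
        (J(-1 | C) * J(s | C) * J(t | C)) *
        ((if A % 4 = 3 ∧ B % 4 = 3 then -1 else 1) * (if B % 4 = 3 ∧ C % 4 = 3 then -1 else 1) *
          (if C % 4 = 3 ∧ A % 4 = 3 then -1 else 1)) := by
  rw [← jacobiSym.mul_swap hA hB hAB, ← jacobiSym.mul_swap hB hC hBC,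
    ← jacobiSym.mul_swap hC hA hCA]
  have e1 : -((t * B) * (k * (u * C))) = -1 * (t * B) * (k * (u * C)) := by ring
  have e2 : -((s * A) * (k * (u * C))) = -1 * (s * A) * (k * (u * C)) := by ring
  have e3 : -((s * A) * (t * B)) = -1 * (s * A) * (t * B) := by ring
  rw [e1, e2, e3]
  simp only [jacobiSym.mul_left]
  ring

theorem jacobiSym.sign_eq_ite {s : ℤ} {n : ℕ} (hs : s = 1 ∨ s = -1) (hn : Odd n) :
    J(s | n) = if s = 1 ∨ n % 4 = 1 then 1 else -1 := by
  rcases hs with rfl | rfl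
  · simp
  · simp [jacobiSym.at_neg_one_eq_ite hn]

set_option synthInstance.maxHeartbeats 400000 in
set_option synthInstance.maxSize 10000 in
theorem jacobiSym.product_eq_one_iff_of_odd {a b c : ℤ} (ha : ¬ 2 ∣ a) (hb : ¬ 2 ∣ b)
    (hc : ¬ 2 ∣ c) (hab : IsCoprime a b) (hbc : IsCoprime b c) (hca : IsCoprime c a) :
    J(-(b * c) | a.natAbs) * J(-(a * c) | b.natAbs) * J(-(a * b) | c.natAbs) = 1 ↔
      ((4 ∣ a + b ∨ 4 ∣ b + c ∨ 4 ∣ c + a) ↔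
        (¬ (0 < a ∧ 0 < b ∧ 0 < c) ∧ ¬ (a < 0 ∧ b < 0 ∧ c < 0))) := by
  obtain ⟨s, hs, has⟩ := Int.exists_sign_mul_natAbs (a := a) (by omega)
  obtain ⟨t, ht, hbt⟩ := Int.exists_sign_mul_natAbs (a := b) (by omega)
  obtain ⟨u, hu, hcu⟩ := Int.exists_sign_mul_natAbs (a := c) (by omega)
  have hA : Odd a.natAbs := by rw [Nat.odd_iff]; omega
  have hB : Odd b.natAbs := by rw [Nat.odd_iff]; omega
  have hC : Odd c.natAbs := by rw [Nat.odd_iff]; omega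
  have key := jacobiSym.product_eq (k := 1) (s := s) (t := t) (u := u) hA hB hC
    (Int.isCoprime_iff_gcd_eq_one.1 hab) (Int.isCoprime_iff_gcd_eq_one.1 hbc)
    (Int.isCoprime_iff_gcd_eq_one.1 hca)
  have hs' : s = 1 ∨ s = -1 := by tauto
  have ht' : t = 1 ∨ t = -1 := by tauto
  have hu' : u = 1 ∨ u = -1 := by tauto
  rw [← has, ← hbt, ← hcu, one_mul] at key
  rw [key]
  simp only [jacobiSym.one_left, jacobiSym.at_neg_one_eq_ite, jacobiSym.sign_eq_ite, hA, hB, hC,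
    hs', ht', hu']
  have e : (4 ∣ a + b ∨ 4 ∣ b + c ∨ 4 ∣ c + a) ↔
      (4 ∣ s * (a.natAbs % 4 : ℕ) + t * (b.natAbs % 4 : ℕ) ∨
        4 ∣ t * (b.natAbs % 4 : ℕ) + u * (c.natAbs % 4 : ℕ) ∨
        4 ∣ u * (c.natAbs % 4 : ℕ) + s * (a.natAbs % 4 : ℕ)) := by
    obtain ⟨i, hi⟩ := Int.exists_eq_mul_mod_add has 4
    obtain ⟨j, hj⟩ := Int.exists_eq_mul_mod_add hbt 4
    obtain ⟨k, hk⟩ := Int.exists_eq_mul_mod_add hcu 4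
    generalize s * ((a.natAbs % 4 : ℕ) : ℤ) = x at *
    generalize t * ((b.natAbs % 4 : ℕ) : ℤ) = y at *
    generalize u * ((c.natAbs % 4 : ℕ) : ℤ) = z at *
    clear has hbt hcu key hs ht hu hA hB hC ha hb hc
    refine or_congr ?_ (or_congr ?_ ?_) <;> omega
  have e' : (¬ (0 < a ∧ 0 < b ∧ 0 < c) ∧ ¬ (a < 0 ∧ b < 0 ∧ c < 0)) ↔ ¬ (s = t ∧ t = u) := by
    rcases hs with ⟨rfl, hs⟩ | ⟨rfl, hs⟩ <;> rcases ht with ⟨rfl, ht⟩ | ⟨rfl, ht⟩ <;>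
      rcases hu with ⟨rfl, hu⟩ | ⟨rfl, hu⟩ <;>
      simp [hs, ht, hu, hs.le, ht.le, hu.le]
  rw [e, e']
  have hA4 : a.natAbs % 4 < 4 := Nat.mod_lt _ (by norm_num)
  have hB4 : b.natAbs % 4 < 4 := Nat.mod_lt _ (by norm_num)
  have hC4 : c.natAbs % 4 < 4 := Nat.mod_lt _ (by norm_num)
  have oA : a.natAbs % 4 % 2 = 1 := by
    rw [Nat.mod_mod_of_dvd _ (by norm_num), Nat.odd_iff.1 hA]
  have oB : b.natAbs % 4 % 2 = 1 := by
    rw [Nat.mod_mod_of_dvd _ (by norm_num), Nat.odd_iff.1 hB]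
  have oC : c.natAbs % 4 % 2 = 1 := by
    rw [Nat.mod_mod_of_dvd _ (by norm_num), Nat.odd_iff.1 hC]
  clear key e e' has hbt hcu hs ht hu
  generalize a.natAbs % 4 = A at *
  generalize b.natAbs % 4 = B at *
  generalize c.natAbs % 4 = C at *
  clear hA hB hC ha hb hc hab hbc hca
  clear a b c
  rcases hs' with rfl | rfl <;> rcases ht' with rfl | rfl <;> rcases hu' with rfl | rfl <;>
    (revert C; revert B; revert A; decide +kernel)

set_option synthInstance.maxHeartbeats 400000 in
set_option synthInstance.maxSize 10000 in
theorem jacobiSym.product_eq_one_iff_of_even {a b c : ℤ} (ha : ¬ 2 ∣ a) (hb : ¬ 2 ∣ b)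
    (hc : ¬ 2 ∣ c) (hab : IsCoprime a b) (hbc : IsCoprime b c) (hca : IsCoprime c a) :
    J(-(b * (2 * c)) | a.natAbs) * J(-(a * (2 * c)) | b.natAbs) * J(-(a * b) | c.natAbs) = 1 ↔
      ((8 ∣ a + b ∨ 8 ∣ a + b + 2 * c) ↔
        (¬ (0 < a ∧ 0 < b ∧ 0 < c) ∧ ¬ (a < 0 ∧ b < 0 ∧ c < 0))) := by
  obtain ⟨s, hs, has⟩ := Int.exists_sign_mul_natAbs (a := a) (by omega)
  obtain ⟨t, ht, hbt⟩ := Int.exists_sign_mul_natAbs (a := b) (by omega)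
  obtain ⟨u, hu, hcu⟩ := Int.exists_sign_mul_natAbs (a := c) (by omega)
  have hA : Odd a.natAbs := by rw [Nat.odd_iff]; omega
  have hB : Odd b.natAbs := by rw [Nat.odd_iff]; omega
  have hC : Odd c.natAbs := by rw [Nat.odd_iff]; omega
  have key := jacobiSym.product_eq (k := 2) (s := s) (t := t) (u := u) hA hB hC
    (Int.isCoprime_iff_gcd_eq_one.1 hab) (Int.isCoprime_iff_gcd_eq_one.1 hbc)
    (Int.isCoprime_iff_gcd_eq_one.1 hca)
  have hs' : s = 1 ∨ s = -1 := by tauto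
  have ht' : t = 1 ∨ t = -1 := by tauto
  have hu' : u = 1 ∨ u = -1 := by tauto
  rw [← has, ← hbt, ← hcu] at key
  rw [key]
  simp only [jacobiSym.at_two_eq_ite, jacobiSym.at_neg_one_eq_ite, jacobiSym.sign_eq_ite,
    hA, hB, hC, hs', ht', hu']
  have e : (8 ∣ a + b ∨ 8 ∣ a + b + 2 * c) ↔
      (8 ∣ s * (a.natAbs % 8 : ℕ) + t * (b.natAbs % 8 : ℕ) ∨
        8 ∣ s * (a.natAbs % 8 : ℕ) + t * (b.natAbs % 8 : ℕ) + 2 * (u * (c.natAbs % 4 : ℕ))) := by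
    obtain ⟨i, hi⟩ := Int.exists_eq_mul_mod_add has 8
    obtain ⟨j, hj⟩ := Int.exists_eq_mul_mod_add hbt 8
    obtain ⟨k, hk⟩ := Int.exists_eq_mul_mod_add hcu 4
    generalize s * ((a.natAbs % 8 : ℕ) : ℤ) = x at *
    generalize t * ((b.natAbs % 8 : ℕ) : ℤ) = y at *
    generalize u * ((c.natAbs % 4 : ℕ) : ℤ) = z at *
    clear has hbt hcu key hs ht hu hA hB hC ha hb hc
    refine or_congr ?_ ?_ <;> omega
  have e' : (¬ (0 < a ∧ 0 < b ∧ 0 < c) ∧ ¬ (a < 0 ∧ b < 0 ∧ c < 0)) ↔ ¬ (s = t ∧ t = u) := by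
    rcases hs with ⟨rfl, hs⟩ | ⟨rfl, hs⟩ <;> rcases ht with ⟨rfl, ht⟩ | ⟨rfl, ht⟩ <;>
      rcases hu with ⟨rfl, hu⟩ | ⟨rfl, hu⟩ <;>
      simp [hs, ht, hu, hs.le, ht.le, hu.le]
  rw [e, e', ← Nat.mod_mod_of_dvd a.natAbs (by norm_num : 4 ∣ 8),
    ← Nat.mod_mod_of_dvd b.natAbs (by norm_num : 4 ∣ 8)]
  have hA4 : a.natAbs % 8 < 8 := Nat.mod_lt _ (by norm_num)
  have hB4 : b.natAbs % 8 < 8 := Nat.mod_lt _ (by norm_num)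
  have hC4 : c.natAbs % 4 < 4 := Nat.mod_lt _ (by norm_num)
  have oA : a.natAbs % 8 % 2 = 1 := by
    rw [Nat.mod_mod_of_dvd _ (by norm_num), Nat.odd_iff.1 hA]
  have oB : b.natAbs % 8 % 2 = 1 := by
    rw [Nat.mod_mod_of_dvd _ (by norm_num), Nat.odd_iff.1 hB]
  have oC : c.natAbs % 4 % 2 = 1 := by
    rw [Nat.mod_mod_of_dvd _ (by norm_num), Nat.odd_iff.1 hC]
  clear key e e' has hbt hcu hs ht hu
  generalize a.natAbs % 8 = A at *
  generalize b.natAbs % 8 = B at *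
  generalize c.natAbs % 4 = C at *
  clear hA hB hC ha hb hc hab hbc hca
  clear a b c
  rcases hs' with rfl | rfl <;> rcases ht' with rfl | rfl <;> rcases hu' with rfl | rfl <;>
    (revert C; revert B; revert A; decide +kernel)

theorem jacobiSym.eq_one_of_forall_prime {d : ℤ} {m : ℕ}
    (h : ∀ ℓ : ℕ, ℓ.Prime → ℓ ∣ m → J(d | ℓ) = 1) : J(d | m) = 1 := by
  by_contra hne
  rcases eq_or_ne m 0 with rfl | hm
  · simp at hne
  obtain ⟨ℓ, hℓ, hdvd, hJ⟩ : ∃ ℓ : ℕ, ℓ.Prime ∧ ℓ ∣ m ∧ J(d | ℓ) ≠ 1 := by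
    clear h
    induction m using Nat.recOnMul with
    | zero => simp at hm
    | one => simp at hne
    | prime ℓ hℓ => exact ⟨ℓ, hℓ, dvd_rfl, hne⟩
    | mul x y ihx ihy =>
      have hx : x ≠ 0 := left_ne_zero_of_mul hm
      have hy : y ≠ 0 := right_ne_zero_of_mul hm
      have : NeZero x := ⟨hx⟩
      have : NeZero y := ⟨hy⟩
      rw [jacobiSym.mul_right] at hne
      by_cases h1 : J(d | x) = 1
      · obtain ⟨ℓ, hℓ, h, h'⟩ := ihy (fun h2 => hne (by rw [h1, h2, one_mul])) hy
        exact ⟨ℓ, hℓ, h.mul_left _, h'⟩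
      · obtain ⟨ℓ, hℓ, h, h'⟩ := ihx h1 hx
        exact ⟨ℓ, hℓ, h.mul_right _, h'⟩
  exact hJ (h ℓ hℓ hdvd)

theorem jacobiSym.eq_one_iff_of_forall_prime_ne {d : ℤ} {m p : ℕ} (hm : Squarefree m)
    (hp : p.Prime) (hpm : p ∣ m)
    (h : ∀ ℓ : ℕ, ℓ.Prime → ℓ ∣ m → ℓ ≠ p → J(d | ℓ) = 1) : J(d | m) = 1 ↔ J(d | p) = 1 := by
  obtain ⟨k, rfl⟩ := hpm
  have : NeZero p := ⟨hp.ne_zero⟩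
  have : NeZero k := ⟨right_ne_zero_of_mul hm.ne_zero⟩
  have hk : J(d | k) = 1 := by
    refine jacobiSym.eq_one_of_forall_prime fun ℓ hℓ hℓk => h ℓ hℓ (hℓk.mul_left p) ?_
    rintro rfl
    exact hℓ.not_isUnit (hm ℓ (mul_dvd_mul_left ℓ hℓk))
  rw [jacobiSym.mul_right, hk, mul_one]

theorem jacobiSym.product_eq_one_iff {P : ∀ ℓ : ℕ, [Fact ℓ.Prime] → Prop} {A B C : ℕ}
    {x y z : ℤ} (sA : Squarefree A) (sB : Squarefree B) (sC : Squarefree C)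
    (oA : ¬ 2 ∣ A) (oB : ¬ 2 ∣ B) (oC : ¬ 2 ∣ C)
    (hAB : A.Coprime B) (hBC : B.Coprime C) (hCA : C.Coprime A)
    (hA : ∀ ℓ [Fact ℓ.Prime], ℓ ∣ A → (P ℓ ↔ J(x | ℓ) = 1))
    (hB : ∀ ℓ [Fact ℓ.Prime], ℓ ∣ B → (P ℓ ↔ J(y | ℓ) = 1))
    (hC : ∀ ℓ [Fact ℓ.Prime], ℓ ∣ C → (P ℓ ↔ J(z | ℓ) = 1))
    (h0 : ∀ ℓ [Fact ℓ.Prime], ℓ ≠ 2 → ¬ ℓ ∣ A → ¬ ℓ ∣ B → ¬ ℓ ∣ C → P ℓ)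
    (p : ℕ) [Fact p.Prime] (h : ∀ ℓ [Fact ℓ.Prime], ℓ ≠ p → P ℓ) :
    J(x | A) * J(y | B) * J(z | C) = 1 ↔ (p ≠ 2 → P p) := by
  have hp : p.Prime := Fact.out
  have one {d : ℤ} {m : ℕ} (hm : ∀ ℓ [Fact ℓ.Prime], ℓ ∣ m → (P ℓ ↔ J(d | ℓ) = 1))
      (hpm : ¬ p ∣ m) : J(d | m) = 1 := by
    refine jacobiSym.eq_one_of_forall_prime fun ℓ hℓ hℓm => ?_
    have : Fact ℓ.Prime := ⟨hℓ⟩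
    exact (hm ℓ hℓm).1 (h ℓ (by rintro rfl; exact hpm hℓm))
  have two {d : ℤ} {m : ℕ} (sm : Squarefree m) (om : ¬ 2 ∣ m)
      (hm : ∀ ℓ [Fact ℓ.Prime], ℓ ∣ m → (P ℓ ↔ J(d | ℓ) = 1))
      (hpm : p ∣ m) : J(d | m) = 1 ↔ (p ≠ 2 → P p) := by
    rw [jacobiSym.eq_one_iff_of_forall_prime_ne sm hp hpm, hm p hpm]
    · have : p ≠ 2 := by rintro rfl; exact om hpm
      simp [this]
    · intro ℓ hℓ hℓm hne
      have : Fact ℓ.Prime := ⟨hℓ⟩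
      exact (hm ℓ hℓm).1 (h ℓ hne)
  have cop {m n : ℕ} (hmn : m.Coprime n) (hm : p ∣ m) : ¬ p ∣ n := fun hn =>
    hp.one_lt.ne' (Nat.eq_one_of_dvd_coprimes hmn hm hn)
  by_cases pA : p ∣ A
  · rw [one hB (cop hAB pA), one hC (cop hCA.symm pA), mul_one, mul_one, two sA oA hA pA]
  by_cases pB : p ∣ B
  · rw [one hA pA, one hC (cop hBC pB), one_mul, mul_one, two sB oB hB pB]
  by_cases pC : p ∣ C
  · rw [one hA pA, one hB pB, one_mul, one_mul, two sC oC hC pC]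
  rw [one hA pA, one hB pB, one hC pC]
  simpa using fun h2 => h0 p h2 pA pB pC

/-- Hilbert reciprocity for the ternary form `⟨a, b, c⟩`: if it is isotropic at every prime other
than `p`, then it is isotropic at `p` if and only if it is indefinite. -/
def IsotropicAtIffIndefinite (a b c : ℤ) (p : ℕ) [Fact p.Prime] : Prop :=
  (∀ ℓ [Fact ℓ.Prime], ℓ ≠ p → IsotropicDiag (a : ℚ_[ℓ]) b c) →
    (IsotropicDiag (a : ℚ_[p]) b c ↔
      (¬ (0 < a ∧ 0 < b ∧ 0 < c) ∧ ¬ (a < 0 ∧ b < 0 ∧ c < 0)))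

namespace IsotropicAtIffIndefinite

variable {a b c a' b' c' : ℤ} {p : ℕ} [Fact p.Prime]

theorem of_iff
    (h : ∀ ℓ [Fact ℓ.Prime], IsotropicDiag (a : ℚ_[ℓ]) b c ↔ IsotropicDiag (a' : ℚ_[ℓ]) b' c')
    (hpos : (0 < a ∧ 0 < b ∧ 0 < c) ↔ (0 < a' ∧ 0 < b' ∧ 0 < c'))
    (hneg : (a < 0 ∧ b < 0 ∧ c < 0) ↔ (a' < 0 ∧ b' < 0 ∧ c' < 0))
    (H : IsotropicAtIffIndefinite a' b' c' p) : IsotropicAtIffIndefinite a b c p := by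
  intro hl
  rw [h p, hpos, hneg]
  exact H fun ℓ _ hℓ => (h ℓ).1 (hl ℓ hℓ)

theorem rotate (H : IsotropicAtIffIndefinite a b c p) : IsotropicAtIffIndefinite b c a p :=
  H.of_iff (fun _ _ => ⟨fun h => h.rotate.rotate, fun h => h.rotate⟩) (by tauto) (by tauto)

theorem mul_sq {t : ℤ} (ht : t ≠ 0) (H : IsotropicAtIffIndefinite a b c p) :
    IsotropicAtIffIndefinite (a * t ^ 2) b c p := by
  have ht2 : 0 < t ^ 2 := by positivity
  refine H.of_iff (fun ℓ _ => ?_) ?_ ?_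
  · push_cast
    exact IsotropicDiag.mul_sq_iff (by exact_mod_cast ht)
  · rw [mul_pos_iff_of_pos_right ht2]
  · simp only [mul_neg_iff, ht2, ht2.not_gt, and_true, and_false, false_or]

theorem mul_mul {t : ℤ} (ht : 0 < t) (H : IsotropicAtIffIndefinite a b (t * c) p) :
    IsotropicAtIffIndefinite (t * a) (t * b) c p := by
  refine H.of_iff (fun ℓ _ => ?_) ?_ ?_
  · push_cast
    exact IsotropicDiag.mul_mul_iff (by exact_mod_cast ht.ne')
  · simp only [mul_pos_iff_of_pos_left ht]
  · simp only [mul_neg_iff, ht, ht.not_gt, true_and, false_and, or_false]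

theorem of_squarefree (sa : Squarefree a) (sb : Squarefree b) (sc : Squarefree c)
    (hab : IsCoprime a b) (hbc : IsCoprime b c) (hca : IsCoprime c a)
    (ha : ¬ 2 ∣ a) (hb : ¬ 2 ∣ b) : IsotropicAtIffIndefinite a b c p := by
  intro hl
  have nsq {ℓ : ℕ} [Fact ℓ.Prime] {x : ℤ} (sx : Squarefree x) : ¬ (ℓ ^ 2 : ℤ) ∣ x := fun h =>
    (Nat.prime_iff_prime_int.1 (Fact.out : ℓ.Prime)).not_isUnit (sx ℓ (by rwa [← pow_two]))
  have cop {ℓ : ℕ} [Fact ℓ.Prime] {x y : ℤ} (hxy : IsCoprime x y) (h : (ℓ : ℤ) ∣ x) :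
      ¬ (ℓ : ℤ) ∣ y := fun h' =>
    (Nat.prime_iff_prime_int.1 (Fact.out : ℓ.Prime)).not_isUnit (hxy.isUnit_of_dvd' h h')
  have odd {ℓ : ℕ} {x : ℤ} (hx : ¬ 2 ∣ x) (h : (ℓ : ℤ) ∣ x) : ℓ ≠ 2 := by
    rintro rfl
    exact hx (by exact_mod_cast h)
  have hA : ∀ ℓ [Fact ℓ.Prime], ℓ ∣ a.natAbs →
      (IsotropicDiag (a : ℚ_[ℓ]) b c ↔ J(-(b * c) | ℓ) = 1) := by
    intro ℓ _ h
    rw [← Int.natCast_dvd] at h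
    exact isotropicDiag_iff_of_dvd (odd ha h) h (nsq sa) (cop hab h) (cop hca.symm h)
  have hB : ∀ ℓ [Fact ℓ.Prime], ℓ ∣ b.natAbs →
      (IsotropicDiag (a : ℚ_[ℓ]) b c ↔ J(-(a * c) | ℓ) = 1) := by
    intro ℓ _ h
    rw [← Int.natCast_dvd] at h
    exact ⟨fun H => (isotropicDiag_iff_of_dvd (odd hb h) h (nsq sb) (cop hab.symm h)
      (cop hbc h)).1 H.swap, fun H => ((isotropicDiag_iff_of_dvd (odd hb h) h (nsq sb)
      (cop hab.symm h) (cop hbc h)).2 H).swap⟩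
  have hC : ∀ ℓ [Fact ℓ.Prime], ℓ ≠ 2 → ℓ ∣ c.natAbs →
      (IsotropicDiag (a : ℚ_[ℓ]) b c ↔ J(-(a * b) | ℓ) = 1) := by
    intro ℓ _ h2 h
    rw [← Int.natCast_dvd] at h
    exact ⟨fun H => (isotropicDiag_iff_of_dvd h2 h (nsq sc) (cop hca h)
      (cop hbc.symm h)).1 H.rotate.rotate, fun H => ((isotropicDiag_iff_of_dvd h2 h (nsq sc)
      (cop hca h) (cop hbc.symm h)).2 H).rotate⟩
  have oA : ¬ 2 ∣ a.natAbs := by omega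
  have oB : ¬ 2 ∣ b.natAbs := by omega
  have h0 : ∀ ℓ [Fact ℓ.Prime], ℓ ≠ 2 → ¬ ℓ ∣ a.natAbs → ¬ ℓ ∣ b.natAbs →
      ¬ ℓ ∣ c.natAbs → IsotropicDiag (a : ℚ_[ℓ]) b c := by
    intro ℓ _ h2 h h' h''
    rw [← Int.natCast_dvd] at h h' h''
    exact isotropicDiag_of_not_dvd h2 h h' h''
  by_cases hc : 2 ∣ c
  · obtain ⟨d, rfl⟩ := hc
    have hd : ¬ 2 ∣ d := fun h => by
      have := sc 2 (mul_dvd_mul_left 2 h)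
      exact absurd this (by decide)
    have hbd : IsCoprime b d := hbc.of_mul_right_right
    have hda : IsCoprime d a := hca.of_mul_left_right
    have T1 := jacobiSym.product_eq_one_iff_of_even ha hb hd hab hbd hda
    have T2 := jacobiSym.product_eq_one_iff
      (P := fun ℓ _ => IsotropicDiag (a : ℚ_[ℓ]) b ((2 * d : ℤ) : ℚ_[ℓ])) (C := d.natAbs)
      (Int.squarefree_natAbs.2 sa) (Int.squarefree_natAbs.2 sb)
      (Int.squarefree_natAbs.2 sc.of_mul_right) oA oB (by omega)
      (Int.isCoprime_iff_gcd_eq_one.1 hab) (Int.isCoprime_iff_gcd_eq_one.1 hbd)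
      (Int.isCoprime_iff_gcd_eq_one.1 hda) hA hB
      (fun ℓ _ h => hC ℓ (by rintro rfl; omega) (by rw [Int.natAbs_mul]; exact h.mul_left _))
      (fun ℓ _ h2 h h' h'' => h0 ℓ h2 h h' (by
        rw [Int.natAbs_mul, (Fact.out : ℓ.Prime).dvd_mul, not_or]
        exact ⟨fun h => h2 ((Nat.prime_dvd_prime_iff_eq Fact.out Nat.prime_two).1 h), h''⟩)) p hl
    have T3 := isotropicDiag_two_iff_of_even ha hb (dvd_mul_right 2 d) (by omega)
    rw [← T3] at T1
    have e : (0 < 2 * d ↔ 0 < d) ∧ (2 * d < 0 ↔ d < 0) := by omega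
    rw [e.1, e.2]
    by_cases hp2 : p = 2
    · subst hp2
      rw [← T1, T2]
      simp
    · simp only [hl 2 (Ne.symm hp2), true_iff] at T1
      rw [← T1, T2]
      simp [hp2]
  · have T1 := jacobiSym.product_eq_one_iff_of_odd ha hb hc hab hbc hca
    have T2 := jacobiSym.product_eq_one_iff (P := fun ℓ _ => IsotropicDiag (a : ℚ_[ℓ]) b c)
      (Int.squarefree_natAbs.2 sa) (Int.squarefree_natAbs.2 sb)
      (Int.squarefree_natAbs.2 sc) oA oB (by omega)
      (Int.isCoprime_iff_gcd_eq_one.1 hab) (Int.isCoprime_iff_gcd_eq_one.1 hbc)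
      (Int.isCoprime_iff_gcd_eq_one.1 hca) hA hB
      (fun ℓ _ h => hC ℓ (by rintro rfl; omega) h) h0 p hl
    rw [← isotropicDiag_two_iff_of_odd ha hb hc] at T1
    by_cases hp2 : p = 2
    · subst hp2
      rw [← T1, T2]
      simp
    · simp only [hl 2 (Ne.symm hp2), true_iff] at T1
      rw [← T1, T2]
      simp [hp2]

theorem of_ne_zero (ha : a ≠ 0) (hb : b ≠ 0) (hc : c ≠ 0) :
    IsotropicAtIffIndefinite a b c p := by
  induction hn : (a * b * c).natAbs using Nat.strong_induction_on generalizing a b c with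
  | _ n ih =>
  subst hn
  have sq {a b c : ℤ} (ha : a ≠ 0) (hb : b ≠ 0) (hc : c ≠ 0)
      (ih : ∀ m < (a * b * c).natAbs, ∀ {a b c : ℤ}, a ≠ 0 → b ≠ 0 → c ≠ 0 →
        (a * b * c).natAbs = m → IsotropicAtIffIndefinite a b c p) (h : ¬ Squarefree a) :
      IsotropicAtIffIndefinite a b c p := by
    simp only [Squarefree, not_forall] at h
    obtain ⟨t, ⟨k, rfl⟩, ht⟩ := h
    have ht0 : t ≠ 0 := by rintro rfl; simp at ha
    have hk0 : k ≠ 0 := by rintro rfl; simp at ha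
    have e : t * t * k = k * t ^ 2 := by ring
    rw [e] at ih ⊢
    refine (ih _ ?_ hk0 hb hc rfl).mul_sq ht0
    rw [Int.isUnit_iff_natAbs_eq] at ht
    have h2 : 1 < t.natAbs := by omega
    have e : (k * t ^ 2 * b * c).natAbs = (k * b * c).natAbs * t.natAbs ^ 2 := by
      simp only [Int.natAbs_mul, Int.natAbs_pow]; ring
    rw [e]
    have : 0 < (k * b * c).natAbs := Int.natAbs_pos.2 (by positivity)
    exact lt_mul_of_one_lt_right this (Nat.one_lt_pow two_ne_zero h2)
  have cop {a b c : ℤ} (ha : a ≠ 0) (hb : b ≠ 0) (hc : c ≠ 0)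
      (ih : ∀ m < (a * b * c).natAbs, ∀ {a b c : ℤ}, a ≠ 0 → b ≠ 0 → c ≠ 0 →
        (a * b * c).natAbs = m → IsotropicAtIffIndefinite a b c p) (h : ¬ IsCoprime a b) :
      IsotropicAtIffIndefinite a b c p := by
    rw [Int.isCoprime_iff_gcd_eq_one] at h
    have hg0 : 0 < Int.gcd a b := Int.gcd_pos_of_ne_zero_left _ ha
    obtain ⟨x, hx⟩ := Int.gcd_dvd_left a b
    obtain ⟨y, hy⟩ := Int.gcd_dvd_right a b
    generalize Int.gcd a b = g at *
    subst hx hy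
    have hx0 : x ≠ 0 := right_ne_zero_of_mul ha
    have hy0 : y ≠ 0 := right_ne_zero_of_mul hb
    have hg : (g : ℤ) ≠ 0 := by positivity
    refine (ih _ ?_ hx0 hy0 (mul_ne_zero hg hc) rfl).mul_mul (by positivity)
    have e : (g * x * (g * y) * c).natAbs = (x * y * (g * c)).natAbs * g := by
      simp only [Int.natAbs_mul, Int.natAbs_natCast]; ring
    rw [e]
    have : 0 < (x * y * (g * c)).natAbs := Int.natAbs_pos.2 (by positivity)
    nlinarith [show 2 ≤ g by omega]
  have e1 : a * b * c = b * c * a := by ring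
  have e2 : a * b * c = c * a * b := by ring
  by_cases sa : Squarefree a
  swap
  · exact sq ha hb hc ih sa
  by_cases sb : Squarefree b
  swap
  · exact (sq hb hc ha (e1 ▸ ih) sb).rotate.rotate
  by_cases sc : Squarefree c
  swap
  · exact (sq hc ha hb (e2 ▸ ih) sc).rotate
  by_cases hab : IsCoprime a b
  swap
  · exact cop ha hb hc ih hab
  by_cases hbc : IsCoprime b c
  swap
  · exact (cop hb hc ha (e1 ▸ ih) hbc).rotate.rotate
  by_cases hca : IsCoprime c a
  swap
  · exact (cop hc ha hb (e2 ▸ ih) hca).rotate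
  have odd {x y : ℤ} (hxy : IsCoprime x y) (h : 2 ∣ x) : ¬ 2 ∣ y := fun h' =>
    absurd (hxy.isUnit_of_dvd' h h') (by decide)
  by_cases h2a : 2 ∣ a
  · exact (of_squarefree sb sc sa hbc hca hab (odd hab h2a) (odd hca.symm h2a)).rotate.rotate
  by_cases h2b : 2 ∣ b
  · exact (of_squarefree sc sa sb hca hab hbc (odd hbc h2b) h2a).rotate
  exact of_squarefree sa sb sc hab hbc hca h2a h2b

end IsotropicAtIffIndefinite

theorem PadicInt.isSquare_intCast_of_isSquare {ℓ : ℕ} [Fact ℓ.Prime] {d : ℤ}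
    (h : IsSquare (d : ℚ_[ℓ])) : IsSquare (d : ℤ_[ℓ]) := by
  obtain ⟨t, ht⟩ := h
  have ht1 : ‖t‖ ≤ 1 := by
    have := Padic.norm_int_le_one (p := ℓ) d
    rw [ht, norm_mul] at this
    nlinarith [norm_nonneg t]
  refine ⟨⟨t, ht1⟩, ?_⟩
  apply Subtype.ext
  push_cast
  exact ht

theorem PadicInt.sq_dvd_of_isSquare {ℓ : ℕ} [Fact ℓ.Prime] {d : ℤ}
    (h : IsSquare (d : ℤ_[ℓ])) (hd : (ℓ : ℤ) ∣ d) : (ℓ ^ 2 : ℤ) ∣ d := by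
  obtain ⟨t, ht⟩ := h
  rw [← PadicInt.pow_p_dvd_int_iff, ht, pow_two]
  have h1 : (ℓ : ℤ_[ℓ]) ∣ t * t := by
    rw [← ht]
    exact_mod_cast Int.cast_dvd_cast (α := ℤ_[ℓ]) _ _ hd
  have h2 : (ℓ : ℤ_[ℓ]) ∣ t := (PadicInt.prime_p.dvd_or_dvd h1).elim id id
  exact mul_dvd_mul h2 h2

theorem jacobiSym.ne_neg_one_of_isSquare_padicInt {ℓ : ℕ} [Fact ℓ.Prime] {d : ℤ}
    (h : IsSquare (d : ℤ_[ℓ])) : J(d | ℓ) ≠ -1 := fun hJ => by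
  apply ZMod.nonsquare_of_jacobiSym_eq_neg_one hJ
  simpa using h.map (PadicInt.toZMod (p := ℓ))

theorem exists_jacobiSym_neg_one_eq_neg_one {p : ℕ} (hp : p.Prime) :
    ∃ m : ℕ, ¬ p ∣ m ∧ J(-1 | m) = -1 := by
  have := hp.pos
  refine ⟨4 * p - 1, fun h => ?_, ?_⟩
  · have h1 : p ∣ 1 := by
      have := Nat.dvd_sub (dvd_mul_left p 4) h
      rwa [show 4 * p - (4 * p - 1) = 1 by omega] at this
    exact hp.one_lt.ne' (Nat.dvd_one.1 h1)
  · rw [jacobiSym.at_neg_one_eq_ite (by rw [Nat.odd_iff]; omega), if_neg (by omega)]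

theorem exists_jacobiSym_prime_eq_neg_one {p : ℕ} (hp : p.Prime) :
    ∃ m : ℕ, ¬ p ∣ m ∧ J(p | m) = -1 ∧ J(-p | m) = -1 := by
  rcases hp.eq_two_or_odd' with rfl | hodd
  · refine ⟨5, by norm_num, ?_, ?_⟩ <;> norm_num
  have : Fact p.Prime := ⟨hp⟩
  obtain ⟨x, hx⟩ := FiniteField.exists_nonsquare (F := ZMod p) (by
    rw [ZMod.ringChar_zmod_n]; rintro rfl; revert hodd; decide)
  have hJ : J(x.val | p) = -1 := by
    rw [ZMod.nonsquare_iff_jacobiSym_eq_neg_one]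
    simpa using hx
  have hm4 : (x.val + p ^ 2 * (3 * x.val + 1)) % 4 = 1 := by
    have : p ^ 2 % 4 = 1 := by
      obtain ⟨k, rfl⟩ := hodd
      ring_nf
      omega
    rw [Nat.add_mod, Nat.mul_mod, this]
    omega
  have hJm : J(p | x.val + p ^ 2 * (3 * x.val + 1)) = -1 := by
    rw [jacobiSym.quadratic_reciprocity_one_mod_four' hodd hm4, jacobiSym.mod_left]
    rw [← hJ, jacobiSym.mod_left (x.val : ℤ)]
    congr 1
    push_cast
    rw [pow_two, mul_assoc, Int.add_mul_emod_self_left]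
  refine ⟨_, fun h => ?_, hJm, ?_⟩
  · have h1 : p ∣ x.val :=
      (Nat.dvd_add_left ((dvd_pow_self p two_ne_zero).mul_right _)).1 h
    apply hx
    rw [← ZMod.natCast_eq_zero_iff, ZMod.natCast_zmod_val] at h1
    rw [h1]
    exact IsSquare.zero
  · rw [← neg_one_mul, jacobiSym.mul_left, hJm,
      jacobiSym.at_neg_one_eq_ite (Nat.odd_iff.2 (Nat.odd_of_mod_four_eq_one hm4)), if_pos hm4, one_mul]

theorem Int.eq_one_of_isSquare_padic {p : ℕ} (hp : p.Prime) {d : ℤ} (hd : Squarefree d)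
    (h : ∀ ℓ [Fact ℓ.Prime], ℓ ≠ p → IsSquare (d : ℚ_[ℓ])) : d = 1 := by
  have hJ : ∀ m : ℕ, ¬ p ∣ m → J(d | m) ≠ -1 := by
    intro m hm hJ
    obtain ⟨ℓ, hℓ, hℓm, hJℓ⟩ := jacobiSym.eq_neg_one_at_prime_divisor_of_eq_neg_one hJ
    have : Fact ℓ.Prime := ⟨hℓ⟩
    exact jacobiSym.ne_neg_one_of_isSquare_padicInt
      (PadicInt.isSquare_intCast_of_isSquare (h ℓ (by rintro rfl; exact hm hℓm))) hJℓ
  have hdvd : d ∣ p := by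
    rw [← Int.natAbs_dvd_natAbs, Int.natAbs_natCast]
    have hsub : d.natAbs.primeFactors ⊆ {p} := by
      intro ℓ hℓ
      rw [Finset.mem_singleton]
      by_contra hne
      have hℓp := Nat.prime_of_mem_primeFactors hℓ
      have : Fact ℓ.Prime := ⟨hℓp⟩
      have h2 := PadicInt.sq_dvd_of_isSquare (PadicInt.isSquare_intCast_of_isSquare (h ℓ hne))
        (Int.natCast_dvd.2 (Nat.dvd_of_mem_primeFactors hℓ))
      rw [pow_two] at h2
      exact (Nat.prime_iff_prime_int.1 hℓp).not_isUnit (hd ℓ h2)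
    rw [← Nat.prod_primeFactors_of_squarefree (Int.squarefree_natAbs.2 hd)]
    simpa using Finset.prod_dvd_prod_of_subset _ _ (fun q : ℕ => q) hsub
  rw [← Int.natAbs_dvd_natAbs, Int.natAbs_natCast, Nat.dvd_prime hp] at hdvd
  obtain ⟨m, hm, hm1⟩ := exists_jacobiSym_neg_one_eq_neg_one hp
  obtain ⟨n, hn, hn1, hn2⟩ := exists_jacobiSym_prime_eq_neg_one hp
  rcases hdvd with hd1 | hdp
  · rcases Int.natAbs_eq d with h' | h' <;> rw [hd1] at h'
    · simpa using h'
    · exact absurd (by simpa [h'] using hm1) (hJ m hm)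
  · rcases Int.natAbs_eq d with h' | h' <;> rw [hdp] at h'
    · exact absurd (h' ▸ hn1) (hJ n hn)
    · exact absurd (h' ▸ hn2) (hJ n hn)

theorem Rat.isSquare_of_isSquare_padic {p : ℕ} (hp : p.Prime) {D : ℚ} (hD : D ≠ 0)
    (h : ∀ ℓ [Fact ℓ.Prime], ℓ ≠ p → IsSquare (D : ℚ_[ℓ])) : IsSquare D := by
  obtain ⟨a, b, hab, ha⟩ := Nat.sq_mul_squarefree (D.num * D.den).natAbs
  have hN0 : D.num * D.den ≠ 0 := mul_ne_zero (Rat.num_ne_zero.2 hD) (by simp)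
  have hb0 : b ≠ 0 := by
    rintro rfl
    exact hN0 (Int.natAbs_eq_zero.1 (by rw [← hab]; ring))
  obtain ⟨s, hs, hN⟩ := Int.exists_sign_mul_natAbs hN0
  have hs1 : s.natAbs = 1 := by rcases hs with ⟨rfl, -⟩ | ⟨rfl, -⟩ <;> rfl
  have e : D = (s * a : ℤ) * ((b : ℚ) / D.den) ^ 2 := by
    have hden : (D.den : ℚ) ≠ 0 := by simp
    rw [← hab] at hN
    have : (D.num : ℚ) * D.den = s * (b ^ 2 * a) := by exact_mod_cast hN
    rw [div_pow, ← mul_div_assoc, eq_div_iff (pow_ne_zero 2 hden)]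
    push_cast
    linear_combination this + (D.den : ℚ) * Rat.mul_den_eq_num D
  have hden : (b : ℚ) / D.den ≠ 0 := by simp [hb0]
  have h1 : s * a = 1 := by
    refine Int.eq_one_of_isSquare_padic hp ?_ fun ℓ _ hℓ => ?_
    · rw [← Int.squarefree_natAbs, Int.natAbs_mul, hs1, one_mul]
      exact ha
    · have h2 := h ℓ hℓ
      rw [e] at h2
      obtain ⟨t, ht⟩ := h2
      have hden' : (((b : ℚ) / D.den : ℚ) : ℚ_[ℓ]) ≠ 0 := by exact_mod_cast hden
      refine ⟨t / ((b : ℚ) / D.den : ℚ), ?_⟩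
      rw [div_mul_div_comm, ← ht, eq_div_iff (mul_ne_zero hden' hden')]
      push_cast
      ring
  rw [e, h1]
  exact ⟨b / D.den, by push_cast; ring⟩

end JacobiSymbols

theorem IsotropicDiag.mul_sq_mul_sq_mul_sq_iff {K : Type*} [Field K] {a b c r s t : K}
    (hr : r ≠ 0) (hs : s ≠ 0) (ht : t ≠ 0) :
    IsotropicDiag (a * r ^ 2) (b * s ^ 2) (c * t ^ 2) ↔ IsotropicDiag a b c := by
  have rot {x y z : K} : IsotropicDiag x y z ↔ IsotropicDiag y z x :=
    ⟨fun h => h.rotate, fun h => h.rotate.rotate⟩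
  rw [mul_sq_iff hr, rot, mul_sq_iff hs, rot, mul_sq_iff ht, rot]

theorem isotropicDiag_padic_iff_indefinite {a b c : ℚ} (ha : a ≠ 0) (hb : b ≠ 0) (hc : c ≠ 0)
    (p : ℕ) [Fact p.Prime]
    (h : ∀ ℓ [Fact ℓ.Prime], ℓ ≠ p → IsotropicDiag (a : ℚ_[ℓ]) b c) :
    IsotropicDiag (a : ℚ_[p]) b c ↔
      (¬ (0 < a ∧ 0 < b ∧ 0 < c) ∧ ¬ (a < 0 ∧ b < 0 ∧ c < 0)) := by
  have cast (q : ℚ) (ℓ : ℕ) [Fact ℓ.Prime] :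
      ((q.num * q.den : ℤ) : ℚ_[ℓ]) = q * ((q.den : ℚ) : ℚ_[ℓ]) ^ 2 := by
    have e : ((q.num * q.den : ℤ) : ℚ) = q * (q.den : ℚ) ^ 2 := by
      push_cast
      linear_combination (-(q.den : ℚ)) * Rat.mul_den_eq_num q
    exact_mod_cast congrArg (Rat.cast : ℚ → ℚ_[ℓ]) e
  have den0 (q : ℚ) (ℓ : ℕ) [Fact ℓ.Prime] : ((q.den : ℚ) : ℚ_[ℓ]) ≠ 0 := by simp
  have key (ℓ : ℕ) [Fact ℓ.Prime] :
      IsotropicDiag ((a.num * a.den : ℤ) : ℚ_[ℓ]) ((b.num * b.den : ℤ) : ℚ_[ℓ])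
        ((c.num * c.den : ℤ) : ℚ_[ℓ]) ↔ IsotropicDiag (a : ℚ_[ℓ]) b c := by
    rw [cast a, cast b, cast c]
    exact IsotropicDiag.mul_sq_mul_sq_mul_sq_iff (den0 a ℓ) (den0 b ℓ) (den0 c ℓ)
  have ne {q : ℚ} (hq : q ≠ 0) : q.num * q.den ≠ 0 := mul_ne_zero (Rat.num_ne_zero.2 hq) (by simp)
  have pos (q : ℚ) : 0 < q.num * q.den ↔ 0 < q := by
    rw [mul_pos_iff_of_pos_right (by exact_mod_cast q.den_pos), Rat.num_pos]
  have neg (q : ℚ) : q.num * q.den < 0 ↔ q < 0 := by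
    rw [← Rat.num_neg]
    simp [mul_neg_iff, q.den_pos]
  have main := IsotropicAtIffIndefinite.of_ne_zero (p := p) (ne ha) (ne hb) (ne hc)
    fun ℓ _ hℓ => (key ℓ).2 (h ℓ hℓ)
  simpa only [key, pos, neg] using main

theorem baseChange_padic_equivalent_iff {q₁ q₂ : QuadraticForm ℚ (Fin 2 → ℚ)} {a b c d : ℚ}
    (ha : a ≠ 0) (hb : b ≠ 0) (hc : c ≠ 0) (hd : d ≠ 0)
    (h₁ : q₁.Equivalent (weightedSumSquares ℚ ![a, b]))
    (h₂ : q₂.Equivalent (weightedSumSquares ℚ ![c, d])) (ℓ : ℕ) [Fact ℓ.Prime] :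
    (q₁.baseChange ℚ_[ℓ]).Equivalent (q₂.baseChange ℚ_[ℓ]) ↔
      (∃ t : ℚ_[ℓ], (c * d : ℚ_[ℓ]) = a * b * t ^ 2) ∧ IsotropicDiag (a : ℚ_[ℓ]) b (-c : ℚ) := by
  have e (x y : ℚ) : (fun i => algebraMap ℚ ℚ_[ℓ] (![x, y] i)) = ![(x : ℚ_[ℓ]), (y : ℚ_[ℓ])] := by
    ext i
    fin_cases i <;> simp
  have h₁' := baseChange_equivalent_weightedSumSquares ℚ_[ℓ] h₁
  have h₂' := baseChange_equivalent_weightedSumSquares ℚ_[ℓ] h₂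
  rw [e] at h₁' h₂'
  rw [Rat.cast_neg, IsotropicDiag.neg_iff (by exact_mod_cast ha) (by exact_mod_cast hb),
    ← weightedSumSquares_equivalent_iff (by exact_mod_cast hc) (by exact_mod_cast hd)]
  exact ⟨fun h => (h₁'.symm.trans h).trans h₂', fun h => (h₁'.trans h).trans h₂'.symm⟩

/-- **Corollary 7.5 (signature via local comparison).**
Let `q₁, q₂` be quadratic forms on `Fin 2 → ℚ` with nondegenerate associated bilinear
forms, and `p` a prime. If `q₁ ⊗ ℚ_ℓ ≅ q₂ ⊗ ℚ_ℓ` for all primes `ℓ ≠ p`, then `q₁` is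
positive definite iff either (`q₁ ⊗ ℚ_p ≅ q₂ ⊗ ℚ_p` and `q₂` is positive definite) or
(`q₁ ⊗ ℚ_p ≇ q₂ ⊗ ℚ_p` and `q₂` is negative definite). -/
theorem stmt_0 (p : ℕ) (hp : p.Prime)
    (q₁ q₂ : QuadraticForm ℚ (Fin 2 → ℚ))
    (hq₁ : (QuadraticMap.associated (R := ℚ) q₁).SeparatingLeft)
    (hq₂ : (QuadraticMap.associated (R := ℚ) q₂).SeparatingLeft)
    (hloc : ∀ (ℓ : ℕ) [Fact ℓ.Prime], ℓ ≠ p →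
      (q₁.baseChange ℚ_[ℓ]).Equivalent (q₂.baseChange ℚ_[ℓ])) :
    q₁.PosDef ↔
      (((q₁.baseChange (@Padic p ⟨hp⟩)).Equivalent (q₂.baseChange (@Padic p ⟨hp⟩)) ∧
          q₂.PosDef) ∨
        (¬ (q₁.baseChange (@Padic p ⟨hp⟩)).Equivalent (q₂.baseChange (@Padic p ⟨hp⟩)) ∧
          ∀ v : Fin 2 → ℚ, v ≠ 0 → q₂ v < 0)) := by
  have : Fact p.Prime := ⟨hp⟩
  obtain ⟨a, b, ha, hb, h₁⟩ := exists_equivalent_weightedSumSquares hq₁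
  obtain ⟨c, d, hc, hd, h₂⟩ := exists_equivalent_weightedSumSquares hq₂
  have hequiv := baseChange_padic_equivalent_iff ha hb hc hd h₁ h₂
  have hab : a * b ≠ 0 := mul_ne_zero ha hb
  have hsq : IsSquare (c * d * (a * b)) := by
    refine Rat.isSquare_of_isSquare_padic hp (mul_ne_zero (mul_ne_zero hc hd) hab)
      fun ℓ _ hℓ => ?_
    obtain ⟨⟨t, ht⟩, -⟩ := (hequiv ℓ).1 (hloc ℓ hℓ)
    refine ⟨a * b * t, ?_⟩
    push_cast
    rw [ht]
    ring
  obtain ⟨r, hr⟩ := hsq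
  have hdisc : ∃ t : ℚ_[p], (c * d : ℚ_[p]) = a * b * t ^ 2 := by
    have e : c * d = a * b * (r / (a * b)) ^ 2 := by
      field_simp
      linear_combination hr
    exact ⟨(r / (a * b) : ℚ), by exact_mod_cast congrArg (Rat.cast : ℚ → ℚ_[p]) e⟩
  have hiso := isotropicDiag_padic_iff_indefinite ha hb (neg_ne_zero.2 hc) p
    fun ℓ _ hℓ => ((hequiv ℓ).1 (hloc ℓ hℓ)).2
  have hsign : 0 < c * d * (a * b) := by
    rw [hr]
    have : r ≠ 0 := by
      rintro rfl
      exact mul_ne_zero (mul_ne_zero hc hd) hab (by simpa using hr)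
    exact mul_self_pos.2 this
  rw [hequiv p, hiso, posDef_iff_of_equivalent h₁, posDef_iff_of_equivalent h₂,
    neg_definite_iff_of_equivalent h₂]
  simp only [mul_pos_iff, mul_neg_iff] at hsign
  simp only [hdisc, true_and, neg_pos, neg_lt_zero]
  grind
end

section
/- For every odd prime p and every p-adic unit u ∈ ℚ_p (‖u‖ = 1) which is not a square in ℚ_p, and for all x, y ∈ ℚ_p not both zero, the element x² − u·y² is nonzero and its p-adic valuation is an even integer. -/
namespace Padic

variable {p : ℕ} [Fact p.Prime]

/-- For odd `p`, an element of `ℚ_[p]` close to the square of a unit is a square. -/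
theorem exists_sq_eq_of_norm_sq_sub_lt_one (hp : p ≠ 2) {a u : ℚ_[p]} (ha : ‖a‖ = 1)
    (hu : ‖u‖ ≤ 1) (h : ‖a ^ 2 - u‖ < 1) : ∃ w : ℚ_[p], w ^ 2 = u := by
  have h2 : ‖(2 : ℤ_[p])‖ = 1 := by
    have := (PadicInt.norm_natCast_eq_one_iff (p := p) (n := 2)).2
      ((Nat.coprime_primes Fact.out Nat.prime_two).2 hp)
    simpa using this
  let A : ℤ_[p] := ⟨a, ha.le⟩
  let U : ℤ_[p] := ⟨u, hu⟩
  have hA : ‖A‖ = 1 := ha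
  have hAU : ‖A ^ 2 - U‖ < 1 := h
  obtain ⟨z, hz, -⟩ := hensels_lemma (R := ℤ_[p])
    (F := (Polynomial.X ^ 2 - Polynomial.C U : Polynomial ℤ_[p])) (a := A)
    (by simpa [one_add_one_eq_two, h2, hA] using hAU)
  have hzU : z ^ 2 = U := by simpa [sub_eq_zero] using hz
  exact ⟨z, by exact_mod_cast congrArg ((↑) : ℤ_[p] → ℚ_[p]) hzU⟩

/-- If the unit `u` is not a square, then `x ^ 2 - u * y ^ 2` is as large as its larger term. -/
theorem norm_sq_sub_mul_sq (hp : p ≠ 2) {u : ℚ_[p]} (hu : ‖u‖ = 1)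
    (hsq : ¬ ∃ w : ℚ_[p], w ^ 2 = u) (x y : ℚ_[p]) :
    ‖x ^ 2 - u * y ^ 2‖ = max ‖x‖ ‖y‖ ^ 2 := by
  have hx : ‖x ^ 2‖ = ‖x‖ ^ 2 := norm_pow x 2
  have hy : ‖-(u * y ^ 2)‖ = ‖y‖ ^ 2 := by simp [hu]
  by_cases hxy : ‖x‖ = ‖y‖
  · by_cases hy0 : y = 0
    · simp_all
    have hy0' : ‖y‖ ≠ 0 := norm_ne_zero_iff.2 hy0
    have ha : ‖x / y‖ = 1 := by rw [norm_div, hxy, div_self hy0']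
    have hle : ‖(x / y) ^ 2 - u‖ ≤ 1 := by
      rw [sub_eq_add_neg]
      refine (nonarchimedean ((x / y) ^ 2) (-u)).trans ?_
      rw [norm_pow, norm_neg, ha, hu, one_pow, max_self]
    have heq : ‖(x / y) ^ 2 - u‖ = 1 := hle.antisymm <| not_lt.1 fun h ↦
      hsq (exists_sq_eq_of_norm_sq_sub_lt_one hp ha hu.le h)
    have hfac : x ^ 2 - u * y ^ 2 = ((x / y) ^ 2 - u) * y ^ 2 := by field_simp
    rw [hfac, norm_mul, heq, norm_pow, hxy, max_self, one_mul]
  · have hne : ‖x ^ 2‖ ≠ ‖-(u * y ^ 2)‖ := by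
      rwa [hx, hy, Ne, pow_left_inj₀ (norm_nonneg x) (norm_nonneg y) two_ne_zero]
    rw [sub_eq_add_neg, add_eq_max_of_ne hne, hx, hy]
    rcases le_total ‖x‖ ‖y‖ with h | h
    · rw [max_eq_right h, max_eq_right (by gcongr)]
    · rw [max_eq_left h, max_eq_left (by gcongr)]

/-- The valuation is determined by the norm. -/
theorem valuation_eq_of_norm_eq {a b : ℚ_[p]} (ha : a ≠ 0) (hb : b ≠ 0) (h : ‖a‖ = ‖b‖) :
    a.valuation = b.valuation := by
  have hp : (1 : ℝ) < p := by exact_mod_cast (Fact.out : p.Prime).one_lt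
  rw [norm_eq_zpow_neg_valuation ha, norm_eq_zpow_neg_valuation hb,
    zpow_right_inj₀ (zero_lt_one.trans hp) hp.ne'] at h
  exact neg_injective h

end Padic

/-- **Norms from the unramified quadratic extension have even valuation.**
For `p` an odd prime and `u` a `p`-adic unit which is not a square in `ℚ_p`,
and `x, y ∈ ℚ_p` not both zero, the element `x² − u·y²` is nonzero and its
`p`-adic valuation is even. -/
theorem stmt_3 (p : ℕ) [Fact p.Prime] (hp : p ≠ 2)
    (u : ℚ_[p]) (hu : ‖u‖ = 1) (hsq : ¬ ∃ w : ℚ_[p], w ^ 2 = u)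
    (x y : ℚ_[p]) (hxy : ¬ (x = 0 ∧ y = 0)) :
    x ^ 2 - u * y ^ 2 ≠ 0 ∧ Even (x ^ 2 - u * y ^ 2).valuation := by
  obtain ⟨z, hz, hzn⟩ : ∃ z : ℚ_[p], z ≠ 0 ∧ ‖x ^ 2 - u * y ^ 2‖ = ‖z ^ 2‖ := by
    rw [Padic.norm_sq_sub_mul_sq hp hu hsq]
    rcases le_total ‖x‖ ‖y‖ with h | h
    · refine ⟨y, fun hy ↦ hxy ⟨?_, hy⟩, by rw [max_eq_right h, norm_pow]⟩
      simpa [hy] using h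
    · refine ⟨x, fun hx ↦ hxy ⟨hx, ?_⟩, by rw [max_eq_left h, norm_pow]⟩
      simpa [hx] using h
  have hz2 : z ^ 2 ≠ 0 := pow_ne_zero 2 hz
  have hne : x ^ 2 - u * y ^ 2 ≠ 0 := by
    rwa [← norm_ne_zero_iff, hzn, norm_ne_zero_iff]
  refine ⟨hne, ?_⟩
  rw [Padic.valuation_eq_of_norm_eq hne hz2 hzn, Padic.valuation_pow]
  exact even_two.mul_right _
end

section
/- Let p be an odd prime. Let u ∈ ℚ_p be a nonzero element which is not a square in ℚ_p and whose p-adic valuation is even, and let c ∈ ℚ_p be a nonzero element whose p-adic valuation is odd. Then there do not exist x, y ∈ ℚ_p with x² − c·y² = u. (Equivalently: u is not a norm from the ramified quadratic extension ℚ_p(√c) of ℚ_p.) -/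
open Polynomial in
/-- Elements of the open unit ball around `1` in `ℤ_p`, for `p` odd, are squares. -/
theorem PadicInt.exists_sq_eq_one_sub {p : ℕ} [Fact p.Prime] (hp : p ≠ 2) {t : ℤ_[p]}
    (ht : ‖t‖ < 1) : ∃ w : ℤ_[p], w ^ 2 = 1 - t := by
  have h2 : ‖(2 : ℤ_[p])‖ = 1 := by
    have hcop : IsCoprime (2 : ℤ) p := by
      rw [show (2 : ℤ) = ((2 : ℕ) : ℤ) from rfl, Nat.isCoprime_iff_coprime,
        Nat.coprime_primes Nat.prime_two Fact.out]
      exact hp.symm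
    have h := (PadicInt.norm_intCast_eq_one_iff (p := p) (z := 2)).2 hcop
    exact_mod_cast h
  have hnorm : ‖(X ^ 2 - C (1 - t) : ℤ_[p][X]).aeval (1 : ℤ_[p])‖ <
      ‖(X ^ 2 - C (1 - t) : ℤ_[p][X]).derivative.aeval (1 : ℤ_[p])‖ ^ 2 := by
    simpa [one_add_one_eq_two, h2] using ht
  obtain ⟨w, hw, -⟩ := hensels_lemma hnorm
  exact ⟨w, by simpa [sub_eq_zero] using hw⟩

/-- If `‖b‖ < ‖x ^ 2‖` in `ℚ_p`, for `p` odd, then `x ^ 2 - b` is a square. -/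
theorem Padic.exists_sq_eq_sq_sub {p : ℕ} [Fact p.Prime] (hp : p ≠ 2) {x b : ℚ_[p]}
    (hb : ‖b‖ < ‖x ^ 2‖) : ∃ w : ℚ_[p], w ^ 2 = x ^ 2 - b := by
  have hpos : 0 < ‖x ^ 2‖ := (norm_nonneg b).trans_lt hb
  have hx : x ^ 2 ≠ 0 := norm_pos_iff.1 hpos
  have ht : ‖b / x ^ 2‖ < 1 := by rwa [norm_div, div_lt_one hpos]
  obtain ⟨t, hbt⟩ : ∃ t : ℤ_[p], (t : ℚ_[p]) = b / x ^ 2 := ⟨⟨b / x ^ 2, ht.le⟩, rfl⟩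
  rw [← hbt, ← PadicInt.norm_def] at ht
  obtain ⟨w, hw⟩ := PadicInt.exists_sq_eq_one_sub hp ht
  have hw' : (w : ℚ_[p]) ^ 2 = 1 - b / x ^ 2 := by
    rw [← PadicInt.coe_pow, hw, PadicInt.coe_sub, PadicInt.coe_one, hbt]
  exact ⟨x * w, by rw [mul_pow, hw', mul_sub, mul_one, mul_div_cancel₀ _ hx]⟩

/-- Nonzero elements of `ℚ_p` with the same norm have the same valuation. -/
theorem Padic.valuation_eq_of_norm_eq_s5 {p : ℕ} [Fact p.Prime] {a b : ℚ_[p]} (ha : a ≠ 0)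
    (hb : b ≠ 0) (h : ‖a‖ = ‖b‖) : a.valuation = b.valuation := by
  have hp : 1 < (p : ℝ) := mod_cast (Fact.out : p.Prime).one_lt
  rw [Padic.norm_eq_zpow_neg_valuation ha, Padic.norm_eq_zpow_neg_valuation hb] at h
  exact neg_injective (zpow_right_injective₀ (zero_lt_one.trans hp) hp.ne' h)

/-- An element of even valuation and an element `c * y ^ 2` with `c` of odd valuation
have different norms. -/
theorem Padic.norm_ne_norm_mul_sq {p : ℕ} [Fact p.Prime] {a c : ℚ_[p]} (y : ℚ_[p]) (ha : a ≠ 0)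
    (haeven : Even a.valuation) (hc : c ≠ 0) (hcodd : Odd c.valuation) :
    ‖a‖ ≠ ‖c * y ^ 2‖ := by
  intro h
  have hcy : c * y ^ 2 ≠ 0 := norm_ne_zero_iff.1 (h ▸ norm_ne_zero_iff.2 ha)
  have hy : y ^ 2 ≠ 0 := right_ne_zero_of_mul hcy
  rw [Padic.valuation_eq_of_norm_eq_s5 ha hcy h, Padic.valuation_mul hc hy, Padic.valuation_pow]
    at haeven
  rw [← Int.not_even_iff_odd] at hcodd
  exact hcodd ((Int.even_add.1 haeven).2 (by simp))

/-- **Lemma 9.13 (norms from a ramified quadratic extension).**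
For `p` an odd prime, `u ∈ ℚ_p` nonzero, not a square, of even valuation, and
`c ∈ ℚ_p` nonzero of odd valuation, there are no `x, y ∈ ℚ_p` with `x² − c·y² = u`. -/
theorem stmt_5 (p : ℕ) [Fact p.Prime] (hp : p ≠ 2)
    (u : ℚ_[p]) (hu0 : u ≠ 0) (hsq : ¬ ∃ w : ℚ_[p], w ^ 2 = u)
    (hueven : Even u.valuation)
    (c : ℚ_[p]) (hc0 : c ≠ 0) (hcodd : Odd c.valuation) :
    ¬ ∃ x y : ℚ_[p], x ^ 2 - c * y ^ 2 = u := by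
  rintro ⟨x, y, rfl⟩
  have hle : ‖x ^ 2‖ ≤ ‖c * y ^ 2‖ :=
    not_lt.1 fun h => hsq (Padic.exists_sq_eq_sq_sub hp h)
  have hne : ‖x ^ 2‖ ≠ ‖c * y ^ 2‖ := by
    by_cases hx : x = 0
    · subst hx
      intro h
      have hy : c * y ^ 2 = 0 := norm_eq_zero.1 (by simpa using h.symm)
      exact hu0 (by simp [hy])
    · exact Padic.norm_ne_norm_mul_sq y (pow_ne_zero 2 hx) (by simp [Padic.valuation_pow])
        hc0 hcodd
  refine Padic.norm_ne_norm_mul_sq y hu0 hueven hc0 hcodd ?_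
  rw [sub_eq_add_neg, Padic.add_eq_max_of_ne (by rwa [norm_neg]), norm_neg, max_eq_right hle]
end

section
/- For all u, v ∈ ℚ₂, u² − 3·v² ≠ −9. (Equivalently: −9 is not a norm from the extension ℚ₂(√3) of ℚ₂.) -/
theorem Padic.exists_padicInt_of_sq_eq {p : ℕ} [Fact p.Prime] {t : ℚ_[p]} {x : ℤ_[p]}
    (h : t ^ 2 = x) : ∃ a : ℤ_[p], (a : ℚ_[p]) = t ∧ a ^ 2 = x := by
  have ht : ‖t‖ ≤ 1 := by
    rw [← sq_le_one_iff₀ (norm_nonneg t), ← norm_pow, h]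
    exact x.norm_le_one
  exact ⟨⟨t, ht⟩, rfl, Subtype.coe_injective ((PadicInt.coe_pow _ _).trans h)⟩

theorem ZMod.sq_add_sq_ne_three : ∀ a b : ZMod (2 ^ 2), a ^ 2 + b ^ 2 ≠ 3 := by
  decide

theorem PadicInt.sq_add_sq_ne_three_add_four_mul (a b c : ℤ_[2]) :
    a ^ 2 + b ^ 2 ≠ 3 + 4 * c := by
  intro h
  have h4 : (4 : ZMod (2 ^ 2)) = 0 := by decide
  have h' := congrArg (PadicInt.toZModPow 2) h
  simp only [map_add, map_mul, map_pow, map_ofNat, h4, zero_mul, add_zero] at h'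
  exact ZMod.sq_add_sq_ne_three _ _ h'

/-- **Lemma 9.22 (`−9` is not a norm from `ℚ₂(√3)`).**
For all `u, v ∈ ℚ₂`, `u² − 3·v² ≠ −9`. -/
theorem stmt_7 (u v : ℚ_[2]) : u ^ 2 - 3 * v ^ 2 ≠ -9 := by
  intro h
  have h3 : ((3 : ℤ_[2]) : ℚ_[2]) = 3 := rfl
  have h9 : ((9 : ℤ_[2]) : ℚ_[2]) = 9 := rfl
  rcases le_total ‖v‖ 1 with hv | hv
  · obtain ⟨v, rfl⟩ : ∃ b : ℤ_[2], (b : ℚ_[2]) = v := ⟨⟨v, hv⟩, rfl⟩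
    obtain ⟨a, -, ha⟩ := Padic.exists_padicInt_of_sq_eq (t := u) (x := 3 * v ^ 2 - 9)
      (by push_cast; rw [h3, h9]; linear_combination h)
    exact PadicInt.sq_add_sq_ne_three_add_four_mul a v (v ^ 2 - 3) (by linear_combination ha)
  · have hv0 : v ≠ 0 := norm_pos_iff.mp (zero_lt_one.trans_le hv)
    obtain ⟨s, hs⟩ : ∃ s : ℤ_[2], (s : ℚ_[2]) = v⁻¹ :=
      ⟨⟨v⁻¹, by rw [norm_inv]; exact inv_le_one_of_one_le₀ hv⟩, rfl⟩
    obtain ⟨a, -, ha⟩ := Padic.exists_padicInt_of_sq_eq (t := u / v) (x := 3 - 9 * s ^ 2)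
      (by push_cast; rw [h3, h9, hs]; field_simp; linear_combination h)
    exact PadicInt.sq_add_sq_ne_three_add_four_mul a s (-2 * s ^ 2) (by linear_combination ha)
end

section
/- Fix a real number q > 0. Let Σ be a finite type with 8 elements, c : Σ → Σ an involution with no fixed points, and α : Σ → ℂ a function such that α(σ)·conj(α(σ)) = q and α(c(σ)) = conj(α(σ)) for every σ ∈ Σ. If I and J are exotic subsets of Σ, then the cardinality of I ∩ J is not equal to 2. -/
open Finset

/-- A finset `I` of Frobenius eigenvalue indices is *exotic* if it has four elements,
the product of the corresponding eigenvalues is `q²`, and for every `n ≥ 1` and all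
distinct `σ, τ ∈ I` one has `α(σ)ⁿ ≠ conj(α(τ))ⁿ`. -/
def IsExotic (q : ℝ) {S : Type*} (α : S → ℂ) (I : Finset S) : Prop :=
  I.card = 4 ∧ (∏ σ ∈ I, α σ) = (q : ℂ) ^ 2 ∧
    ∀ n : ℕ, 1 ≤ n → ∀ σ ∈ I, ∀ τ ∈ I, σ ≠ τ →
      α σ ^ n ≠ (starRingEnd ℂ) (α τ) ^ n

/-- An exotic set contains at most one member of each conjugate pair. -/
theorem IsExotic.conj_notMem {q : ℝ} {S : Type*} {α : S → ℂ} {c : S → S} {I : Finset S}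
    (hI : IsExotic q α I) (hcfix : ∀ σ, c σ ≠ σ)
    (hconj : ∀ σ, α (c σ) = (starRingEnd ℂ) (α σ)) {σ : S} (hσ : σ ∈ I) : c σ ∉ I := fun h =>
  hI.2.2 1 le_rfl σ hσ (c σ) h (hcfix σ).symm (by simp [hconj])

/-- An exotic set in a type with eight elements meets every conjugate pair. -/
theorem IsExotic.conj_mem_of_notMem {q : ℝ} {S : Type*} [Fintype S] [DecidableEq S]
    (hcard : Fintype.card S = 8) {α : S → ℂ} {c : S → S} (hc : Function.Involutive c)
    (hcfix : ∀ σ, c σ ≠ σ) (hconj : ∀ σ, α (c σ) = (starRingEnd ℂ) (α σ)) {I : Finset S}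
    (hI : IsExotic q α I) {σ : S} (hσ : σ ∉ I) : c σ ∈ I := by
  have hdisj : Disjoint I (I.image c) := by
    rw [Finset.disjoint_right]
    intro τ hτ
    obtain ⟨ρ, hρ, rfl⟩ := Finset.mem_image.mp hτ
    exact hI.conj_notMem hcfix hconj hρ
  have huniv : I ∪ I.image c = Finset.univ := by
    rw [← Finset.card_eq_iff_eq_univ, Finset.card_union_of_disjoint hdisj,
      Finset.card_image_of_injective _ hc.injective, hI.1, hcard]
  have hmem := huniv ▸ Finset.mem_univ σ
  obtain ⟨ρ, hρ, rfl⟩ := Finset.mem_image.mp ((Finset.mem_union.mp hmem).resolve_left hσ)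
  rwa [hc ρ]

/-- If the product of two complex numbers of equal nonzero norm is real, then the first is, up to
sign, the conjugate of the second. -/
theorem sq_eq_conj_sq_of_mul_eq_conj_mul {r x y : ℂ} (hr : r ≠ 0)
    (hx : x * (starRingEnd ℂ) x = r) (hy : y * (starRingEnd ℂ) y = r)
    (h : x * y = (starRingEnd ℂ) x * (starRingEnd ℂ) y) : x ^ 2 = (starRingEnd ℂ) y ^ 2 := by
  apply mul_left_cancel₀ hr
  linear_combination (-x ^ 2) * hy + x * (starRingEnd ℂ) y * h + (starRingEnd ℂ) y ^ 2 * hx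

/-- **Lemma 5.9 (two exotic subsets cannot meet in exactly two elements).** -/
theorem stmt_8 (q : ℝ) (hq : 0 < q)
    (S : Type*) [Fintype S] [DecidableEq S] (hcard : Fintype.card S = 8)
    (c : S → S) (hc : Function.Involutive c) (hcfix : ∀ σ, c σ ≠ σ)
    (α : S → ℂ)
    (hweil : ∀ σ, α σ * (starRingEnd ℂ) (α σ) = (q : ℂ))
    (hconj : ∀ σ, α (c σ) = (starRingEnd ℂ) (α σ))
    (I J : Finset S) (hI : IsExotic q α I) (hJ : IsExotic q α J) :
    (I ∩ J).card ≠ 2 := by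
  intro hcap
  have hq0 : (q : ℂ) ≠ 0 := by exact_mod_cast hq.ne'
  have hα : ∀ σ, α σ ≠ 0 := fun σ h => hq0 (by simpa [h] using (hweil σ).symm)
  have hIJ : (I \ J).card = 2 := by
    have := Finset.card_inter_add_card_sdiff I J
    have := hI.1
    omega
  have hJI : (J \ I).card = 2 := by
    have := Finset.card_inter_add_card_sdiff J I
    have := hJ.1
    rw [Finset.inter_comm] at hcap
    omega
  have himage : (I \ J).image c = J \ I := by
    apply Finset.eq_of_subset_of_card_le
    · intro τ hτ
      obtain ⟨σ, hσ, rfl⟩ := Finset.mem_image.mp hτ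
      obtain ⟨hσI, hσJ⟩ := Finset.mem_sdiff.mp hσ
      exact Finset.mem_sdiff.mpr ⟨hJ.conj_mem_of_notMem hcard hc hcfix hconj hσJ,
        hI.conj_notMem hcfix hconj hσI⟩
    · rw [Finset.card_image_of_injective _ hc.injective, hIJ, hJI]
  have hprod : ∏ σ ∈ I \ J, α σ = ∏ σ ∈ I \ J, (starRingEnd ℂ) (α σ) := by
    have hImul := Finset.prod_inter_mul_prod_sdiff I J α
    have hJmul := Finset.prod_inter_mul_prod_sdiff J I α
    rw [Finset.inter_comm, ← himage, Finset.prod_image hc.injective.injOn, hJ.2.1, ← hI.2.1,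
      ← hImul] at hJmul
    simp only [hconj] at hJmul
    exact (mul_left_cancel₀ (Finset.prod_ne_zero_iff.mpr fun σ _ => hα σ) hJmul).symm
  obtain ⟨x, y, hxy, hset⟩ := Finset.card_eq_two.mp hIJ
  rw [hset, Finset.prod_pair hxy, Finset.prod_pair hxy] at hprod
  have hsub : I \ J ⊆ I := Finset.sdiff_subset
  exact hI.2.2 2 one_le_two x (hsub (by simp [hset])) y (hsub (by simp [hset])) hxy
    (sq_eq_conj_sq_of_mul_eq_conj_mul hq0 (hweil x) (hweil y) hprod)
end

section
/- Fix a real number q > 0. Let Σ be a finite type with 8 elements, c : Σ → Σ an involution with no fixed points, and α : Σ → ℂ a function such that α(σ)·conj(α(σ)) = q and α(c(σ)) = conj(α(σ)) for every σ ∈ Σ. Then there are at most four exotic subsets of Σ: the set of exotic finsets has cardinality at most 4. -/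
open Finset

/-- `I` contains exactly one point of each orbit `{σ, c σ}`. -/
def IsOrbitSection {S : Type*} (c : S → S) (I : Finset S) : Prop :=
  ∀ σ, c σ ∈ I ↔ σ ∉ I

namespace IsOrbitSection

variable {S : Type*} [DecidableEq S] {c : S → S} {I J K : Finset S}

theorem sdiff_eq_image_sdiff (hJ : IsOrbitSection c J) (hK : IsOrbitSection c K)
    (hc : Function.Involutive c) : K \ J = (J \ K).image c := by
  ext σ
  simp only [mem_image, mem_sdiff]
  constructor
  · rintro ⟨h1, h2⟩
    exact ⟨c σ, ⟨(hJ σ).2 h2, fun h => (hK σ).1 h h1⟩, hc σ⟩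
  · rintro ⟨τ, ⟨h1, h2⟩, rfl⟩
    exact ⟨(hK τ).2 h2, fun h => (hJ τ).1 h h1⟩

theorem card_sdiff_eq (hJ : IsOrbitSection c J) (hK : IsOrbitSection c K)
    (hc : Function.Involutive c) (hI : IsOrbitSection c I) :
    (J \ K).card = ((I \ K) \ (I \ J)).card + ((I \ J) \ (I \ K)).card := by
  have h : J \ K = ((I \ K) \ (I \ J)) ∪ ((I \ J) \ (I \ K)).image c := by
    ext σ
    have h1 := hI σ
    have h2 := hJ σ
    have h3 := hK σ
    simp only [mem_union, mem_image, mem_sdiff]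
    constructor
    · intro h
      by_cases hσ : σ ∈ I
      · left; tauto
      · right; exact ⟨c σ, by tauto, hc σ⟩
    · rintro (h | ⟨τ, h, rfl⟩)
      · tauto
      · have h4 := hJ τ
        have h5 := hK τ
        tauto
  rw [h, card_union_of_disjoint, card_image_of_injective _ hc.injective]
  rw [disjoint_left]
  intro σ h1 h2
  simp only [mem_image, mem_sdiff] at h1 h2
  obtain ⟨τ, h, rfl⟩ := h2
  exact (hI τ).1 h1.1.1 h.1.1

theorem card_sdiff_add_two_mul (hJ : IsOrbitSection c J) (hK : IsOrbitSection c K)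
    (hc : Function.Involutive c) (hI : IsOrbitSection c I) :
    (J \ K).card + 2 * ((I \ J) ∩ (I \ K)).card = (I \ J).card + (I \ K).card := by
  have h1 := card_sdiff_eq hJ hK hc hI
  have h2 := card_sdiff_add_card_inter (I \ K) (I \ J)
  have h3 := card_sdiff_add_card_inter (I \ J) (I \ K)
  rw [inter_comm] at h2
  omega

/-- A point of `S` on which `J` and `K` agree yields a common element of `J` and `K`. -/
theorem inter_nonempty_of_mem_iff (hJ : IsOrbitSection c J) (hK : IsOrbitSection c K)
    {σ : S} (h : σ ∈ J ↔ σ ∈ K) : (J ∩ K).Nonempty := by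
  by_cases hσ : σ ∈ J
  · exact ⟨σ, mem_inter.2 ⟨hσ, h.1 hσ⟩⟩
  · exact ⟨c σ, mem_inter.2 ⟨(hJ σ).2 hσ, (hK σ).2 fun h' => hσ (h.2 h')⟩⟩

end IsOrbitSection

theorem IsExotic.isOrbitSection {q : ℝ} {S : Type*} [Fintype S] [DecidableEq S]
    (hcard : Fintype.card S = 8) {c : S → S} (hc : Function.Involutive c)
    (hcfix : ∀ σ, c σ ≠ σ) {α : S → ℂ} (hconj : ∀ σ, α (c σ) = (starRingEnd ℂ) (α σ))
    {I : Finset S} (hI : IsExotic q α I) : IsOrbitSection c I := by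
  have hnot : ∀ σ ∈ I, c σ ∉ I := fun σ h h' =>
    hI.2.2 1 le_rfl (c σ) h' σ h (hcfix σ) (by rw [hconj])
  have hdisj : Disjoint I (I.image c) := by
    rw [disjoint_left]
    intro σ h1 h2
    obtain ⟨τ, h, rfl⟩ := mem_image.1 h2
    exact hnot τ h h1
  have huniv : I ∪ I.image c = univ := by
    rw [← card_eq_iff_eq_univ, card_union_of_disjoint hdisj,
      card_image_of_injective _ hc.injective, hI.1, hcard]
  refine fun σ => ⟨fun h h' => hnot σ h' h, fun h => ?_⟩
  have hσ : σ ∈ I ∪ I.image c := huniv ▸ mem_univ σ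
  obtain ⟨τ, hτ, rfl⟩ := mem_image.1 ((mem_union.1 hσ).resolve_left h)
  rwa [hc τ]

theorem IsExotic.card_sdiff_ne_two {q : ℝ} (hq : 0 < q) {S : Type*} [DecidableEq S]
    {c : S → S} (hc : Function.Involutive c) {α : S → ℂ}
    (hweil : ∀ σ, α σ * (starRingEnd ℂ) (α σ) = (q : ℂ))
    (hconj : ∀ σ, α (c σ) = (starRingEnd ℂ) (α σ)) {J K : Finset S}
    (hJ : IsExotic q α J) (hK : IsExotic q α K)
    (hJs : IsOrbitSection c J) (hKs : IsOrbitSection c K) : (J \ K).card ≠ 2 := by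
  intro h
  obtain ⟨σ, τ, hne, hst⟩ := card_eq_two.1 h
  have hq0 : (q : ℂ) ≠ 0 := by exact_mod_cast hq.ne'
  have hα : ∀ σ, α σ ≠ 0 := fun σ h0 => hq0 (by rw [← hweil σ, h0, zero_mul])
  have hJK := (prod_inter_mul_prod_sdiff J K α).trans hJ.2.1
  have hKJ := (prod_inter_mul_prod_sdiff K J α).trans hK.2.1
  rw [hJs.sdiff_eq_image_sdiff hKs hc, inter_comm,
    prod_image hc.injective.injOn, hst, prod_pair hne, hconj, hconj] at hKJ
  rw [hst, prod_pair hne] at hJK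
  have hreal : α σ * α τ = (starRingEnd ℂ) (α σ) * (starRingEnd ℂ) (α τ) :=
    mul_left_cancel₀ (prod_ne_zero_iff.2 fun ρ _ => hα ρ) (hJK.trans hKJ.symm)
  have hσ : σ ∈ J := (mem_sdiff.1 (hst ▸ mem_insert_self σ {τ} : σ ∈ J \ K)).1
  have hτ : τ ∈ J :=
    (mem_sdiff.1 (hst ▸ mem_insert_of_mem (mem_singleton_self τ) : τ ∈ J \ K)).1
  refine hJ.2.2 2 one_le_two σ hσ τ hτ hne (mul_right_cancel₀ (pow_ne_zero 2 (hα τ)) ?_)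
  linear_combination α σ * α τ * hreal + α τ * (starRingEnd ℂ) (α τ) * hweil σ
    - α τ * (starRingEnd ℂ) (α τ) * hweil τ

/-- **Lemma 5.10 (there are at most four exotic subsets).** -/
theorem stmt_10 (q : ℝ) (hq : 0 < q)
    (S : Type*) [Fintype S] [DecidableEq S] (hcard : Fintype.card S = 8)
    (c : S → S) (hc : Function.Involutive c) (hcfix : ∀ σ, c σ ≠ σ)
    (α : S → ℂ)
    (hweil : ∀ σ, α σ * (starRingEnd ℂ) (α σ) = (q : ℂ))
    (hconj : ∀ σ, α (c σ) = (starRingEnd ℂ) (α σ)) :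
    {I : Finset S | IsExotic q α I}.ncard ≤ 4 := by
  rcases Set.eq_empty_or_nonempty {I : Finset S | IsExotic q α I} with h | ⟨I, hI⟩
  · simp [h]
  have hsec {J : Finset S} (hJ : IsExotic q α J) : IsOrbitSection c J :=
    hJ.isOrbitSection hcard hc hcfix hconj
  obtain ⟨σ, -⟩ : I.Nonempty := card_pos.1 (by rw [hI.1]; norm_num)
  -- An exotic subset is determined by whether it contains `σ` and by the parity of its
  -- distance to `I`.
  let f : Finset S → Bool × Bool := fun J => (decide (σ ∈ J), decide (Even (I \ J).card))
  have hf : Set.InjOn f {J | IsExotic q α J} := by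
    intro J (hJ : IsExotic q α J) K (hK : IsExotic q α K) hJK
    simp only [f, Prod.mk.injEq, decide_eq_decide, Nat.even_iff] at hJK
    have h1 := (hsec hJ).card_sdiff_add_two_mul (hsec hK) hc (hsec hI)
    have h2 := ((hsec hJ).inter_nonempty_of_mem_iff (hsec hK) hJK.1).card_pos
    have h3 := hJ.card_sdiff_ne_two hq hc hweil hconj hK (hsec hJ) (hsec hK)
    have h4 := card_sdiff_add_card_inter J K
    rw [hJ.1] at h4
    have h0 : (J \ K).card = 0 := by omega
    rw [card_eq_zero, sdiff_eq_empty_iff_subset] at h0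
    exact eq_of_subset_of_card_le h0 (by rw [hJ.1, hK.1])
  rw [← hf.ncard_image]
  calc (f '' {J | IsExotic q α J}).ncard ≤ (Set.univ : Set (Bool × Bool)).ncard :=
        Set.ncard_le_ncard (Set.subset_univ _)
    _ = 4 := by simp [Set.ncard_univ]
end

section
/- Let p be a prime and F a field extension of ℚ_p with [F : ℚ_p] = 2. For i = 1, 2 let V_i be an F-vector space of F-dimension 1 (hence a 2-dimensional ℚ_p-vector space via restriction of scalars), and let q_i be a ℚ_p-quadratic form on V_i satisfying q_i(f • v) = N_{F/ℚ_p}(f) · q_i(v) for all f ∈ F and v ∈ V_i, and q_i(v) ≠ 0 for all v ≠ 0. Then the following are equivalent: (1) q₁ and q₂ are equivalent (isometric) as ℚ_p-quadratic forms; (2) there exist nonzero vectors v₁ ∈ V₁ and v₂ ∈ V₂ and an element f ∈ F with q₁(v₁) = N_{F/ℚ_p}(f) · q₂(v₂); (3) for every pair of nonzero vectors v₁ ∈ V₁ and v₂ ∈ V₂ there exists f ∈ F with q₁(v₁) = N_{F/ℚ_p}(f) · q₂(v₂). -/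
theorem exists_ne_zero_of_finrank_eq_one {F V : Type*} [Field F] [AddCommGroup V] [Module F V]
    (h : Module.finrank F V = 1) : ∃ v : V, v ≠ 0 :=
  have : Nontrivial V := Module.nontrivial_of_finrank_pos (R := F) (h ▸ one_pos)
  exists_ne 0

/-- A nonzero vector of a one-dimensional space identifies the scalar field with the space. -/
noncomputable def LinearEquiv.toSpanSingletonOfFinrankEqOne (F : Type*) {V : Type*} [Field F]
    [AddCommGroup V] [Module F V] (h : Module.finrank F V = 1) (v : V) (hv : v ≠ 0) : F ≃ₗ[F] V :=
  LinearEquiv.ofBijective (LinearMap.toSpanSingleton F V v)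
    ⟨smul_left_injective F hv, fun w ↦ exists_smul_eq_of_finrank_eq_one h hv w⟩

@[simp]
theorem LinearEquiv.toSpanSingletonOfFinrankEqOne_apply {F V : Type*} [Field F]
    [AddCommGroup V] [Module F V] (h : Module.finrank F V = 1) (v : V) (hv : v ≠ 0) (a : F) :
    toSpanSingletonOfFinrankEqOne F h v hv a = a • v :=
  rfl

section NormLike

variable {K F V₁ V₂ : Type*} [Field K] [Field F] [Algebra K F]
  [AddCommGroup V₁] [Module F V₁] [Module K V₁]
  [AddCommGroup V₂] [Module F V₂] [Module K V₂]
  {q₁ : QuadraticForm K V₁} {q₂ : QuadraticForm K V₂}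

/-- For norm-like forms on one-dimensional spaces, the values at nonzero vectors form a single
class modulo norms. -/
theorem QuadraticMap.exists_apply_eq_norm_mul
    (hV₁ : Module.finrank F V₁ = 1) (hV₂ : Module.finrank F V₂ = 1)
    (hq₁ : ∀ (f : F) (v : V₁), q₁ (f • v) = Algebra.norm K f * q₁ v)
    (hq₂ : ∀ (f : F) (v : V₂), q₂ (f • v) = Algebra.norm K f * q₂ v)
    {v₁ : V₁} {v₂ : V₂} {f : F} (hv₁ : v₁ ≠ 0)
    (h : q₁ v₁ = Algebra.norm K f * q₂ v₂) (w₁ : V₁) {w₂ : V₂} (hw₂ : w₂ ≠ 0) :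
    ∃ g : F, q₁ w₁ = Algebra.norm K g * q₂ w₂ := by
  obtain ⟨a, rfl⟩ := exists_smul_eq_of_finrank_eq_one hV₁ hv₁ w₁
  obtain ⟨b, rfl⟩ := exists_smul_eq_of_finrank_eq_one hV₂ hw₂ v₂
  exact ⟨a * f * b, by rw [hq₁, h, hq₂, map_mul, map_mul]; ring⟩

variable [IsScalarTower K F V₁] [IsScalarTower K F V₂]

/-- Two norm-like forms on one-dimensional spaces with a common value at nonzero vectors are
equivalent. -/
theorem QuadraticMap.equivalent_of_norm_smul_of_apply_eq
    (hV₁ : Module.finrank F V₁ = 1) (hV₂ : Module.finrank F V₂ = 1)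
    (hq₁ : ∀ (f : F) (v : V₁), q₁ (f • v) = Algebra.norm K f * q₁ v)
    (hq₂ : ∀ (f : F) (v : V₂), q₂ (f • v) = Algebra.norm K f * q₂ v)
    {v₁ : V₁} {v₂ : V₂} (hv₁ : v₁ ≠ 0) (hv₂ : v₂ ≠ 0) (h : q₁ v₁ = q₂ v₂) :
    q₁.Equivalent q₂ := by
  let e₁ := LinearEquiv.toSpanSingletonOfFinrankEqOne F hV₁ v₁ hv₁
  let e₂ := LinearEquiv.toSpanSingletonOfFinrankEqOne F hV₂ v₂ hv₂
  refine ⟨⟨(e₁.symm.trans e₂).restrictScalars K, fun v ↦ ?_⟩⟩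
  obtain ⟨a, rfl⟩ := e₁.surjective v
  have he : (e₁.symm.trans e₂).restrictScalars K (e₁ a) = e₂ a :=
    congrArg e₂ (e₁.symm_apply_apply a)
  exact (congrArg q₂ he).trans (by simp [e₁, e₂, hq₁, hq₂, h])

end NormLike

/-- **Corollary 8.8 (comparison of norm-like quadratic forms of rank 2).**
Let `F/ℚ_p` be a quadratic field extension. For `i = 1, 2` let `Vᵢ` be a
1-dimensional `F`-vector space and `qᵢ` a `ℚ_p`-quadratic form on `Vᵢ` with
`qᵢ(f • v) = N_{F/ℚ_p}(f) · qᵢ(v)` and `qᵢ(v) ≠ 0` for `v ≠ 0`. Then the following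
are equivalent: (1) `q₁ ≅ q₂`; (2) some pair of nonzero vectors has values equal in
`ℚ_p^*/N(F^*)`; (3) every pair of nonzero vectors has values equal in `ℚ_p^*/N(F^*)`. -/
theorem stmt_12 (p : ℕ) [Fact p.Prime]
    (F : Type*) [Field F] [Algebra ℚ_[p] F] (hF : Module.finrank ℚ_[p] F = 2)
    (V₁ V₂ : Type*)
    [AddCommGroup V₁] [Module F V₁] [Module ℚ_[p] V₁] [IsScalarTower ℚ_[p] F V₁]
    [AddCommGroup V₂] [Module F V₂] [Module ℚ_[p] V₂] [IsScalarTower ℚ_[p] F V₂]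
    (hV₁ : Module.finrank F V₁ = 1) (hV₂ : Module.finrank F V₂ = 1)
    (q₁ : QuadraticForm ℚ_[p] V₁) (q₂ : QuadraticForm ℚ_[p] V₂)
    (hq₁ : ∀ (f : F) (v : V₁), q₁ (f • v) = Algebra.norm ℚ_[p] f * q₁ v)
    (hq₂ : ∀ (f : F) (v : V₂), q₂ (f • v) = Algebra.norm ℚ_[p] f * q₂ v)
    (ha₁ : ∀ v : V₁, v ≠ 0 → q₁ v ≠ 0)
    (ha₂ : ∀ v : V₂, v ≠ 0 → q₂ v ≠ 0) :
    (q₁.Equivalent q₂ ↔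
        ∃ (v₁ : V₁) (v₂ : V₂) (f : F), v₁ ≠ 0 ∧ v₂ ≠ 0 ∧
          q₁ v₁ = Algebra.norm ℚ_[p] f * q₂ v₂) ∧
      ((∃ (v₁ : V₁) (v₂ : V₂) (f : F), v₁ ≠ 0 ∧ v₂ ≠ 0 ∧
          q₁ v₁ = Algebra.norm ℚ_[p] f * q₂ v₂) ↔
        ∀ (v₁ : V₁) (v₂ : V₂), v₁ ≠ 0 → v₂ ≠ 0 →
          ∃ f : F, q₁ v₁ = Algebra.norm ℚ_[p] f * q₂ v₂) := by
  refine ⟨⟨fun ⟨e⟩ ↦ ?_, fun ⟨v₁, v₂, f, hv₁, hv₂, h⟩ ↦ ?_⟩,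
    fun ⟨v₁, v₂, f, hv₁, _, h⟩ w₁ w₂ _ hw₂ ↦
      QuadraticMap.exists_apply_eq_norm_mul hV₁ hV₂ hq₁ hq₂ hv₁ h w₁ hw₂, fun h ↦ ?_⟩
  · obtain ⟨v, hv⟩ := exists_ne_zero_of_finrank_eq_one hV₁
    exact ⟨v, e v, 1, hv, e.toLinearEquiv.map_ne_zero_iff.mpr hv, by simp⟩
  · have hf : f ≠ 0 := by
      rintro rfl
      rw [← hq₂, zero_smul, QuadraticMap.map_zero] at h
      exact ha₁ v₁ hv₁ h
    exact QuadraticMap.equivalent_of_norm_smul_of_apply_eq hV₁ hV₂ hq₁ hq₂ hv₁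
      (smul_ne_zero hf hv₂) (h.trans (hq₂ f v₂).symm)
  · obtain ⟨v₁, hv₁⟩ := exists_ne_zero_of_finrank_eq_one hV₁
    obtain ⟨v₂, hv₂⟩ := exists_ne_zero_of_finrank_eq_one hV₂
    obtain ⟨f, hf⟩ := h v₁ v₂ hv₁ hv₂
    exact ⟨v₁, v₂, f, hv₁, hv₂, hf⟩
end

section
/- Let G be the product group Perm(Fin 4) × Multiplicative (ZMod 2) (isomorphic to S₄ × ℤ/2ℤ), and let H ≤ G be the subgroup (stabilizer of the point 0 in Perm(Fin 4)) × (trivial subgroup), a copy of S₃. Then there are exactly four subgroups of G containing H; that is, the set {K : Subgroup G | H ≤ K} has cardinality 4 (its elements are S₃×1, S₄×1, S₃×ℤ/2ℤ, and G itself). -/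
/-- If `S ≤ G` is maximal and self-normalizing, a subgroup of `G × C` containing `S × 1`, with `C` of
prime order, is a product of one of `S`, `G` and one of `1`, `C`. -/
theorem Subgroup.eq_prod_of_prod_bot_le {G C : Type*} [Group G] [CommGroup C] [IsSimpleGroup C]
    {S : Subgroup G} (hS : IsCoatom S) (hN : normalizer (S : Set G) = S)
    {K : Subgroup (G × C)} (hK : S.prod ⊥ ≤ K) :
    ∃ A : Subgroup G, ∃ B : Subgroup C, (A = S ∨ A = ⊤) ∧ (B = ⊥ ∨ B = ⊤) ∧ K = A.prod B := by
  have hSA : S ≤ K.comap (MonoidHom.inl G C) := fun g hg => hK ⟨hg, rfl⟩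
  have hA : K.comap (MonoidHom.inl G C) = S ∨ K.comap (MonoidHom.inl G C) = ⊤ :=
    (hS.le_iff.1 hSA).symm
  have hfst : ∀ x ∈ K, (x.1, (1 : C)) ∈ K := by
    intro x hx
    rcases hA with h | h
    · have hmem : ∀ t, t ∈ S ↔ (t, (1 : C)) ∈ K := fun t => by rw [← h]; rfl
      rw [← hmem, ← hN, mem_normalizer_iff]
      intro t
      have hconj : (x.1 * t * x.1⁻¹, (1 : C)) = x * (t, 1) * x⁻¹ := by ext <;> simp
      change t ∈ S ↔ x.1 * t * x.1⁻¹ ∈ S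
      rw [hmem, hmem, hconj, K.mul_mem_cancel_right (K.inv_mem hx), K.mul_mem_cancel_left hx]
    · exact (h ▸ mem_top x.1 : x.1 ∈ K.comap (MonoidHom.inl G C))
  refine ⟨_, K.comap (MonoidHom.inr G C), hA,
    (inferInstance : (K.comap (MonoidHom.inr G C)).Normal).eq_bot_or_eq_top, ?_⟩
  ext x
  refine ⟨fun hx => ⟨hfst x hx, ?_⟩, fun ⟨h₁, h₂⟩ => ?_⟩
  · have h := K.mul_mem (K.inv_mem (hfst x hx)) hx
    have hx' : (x.1, (1 : C))⁻¹ * x = (1, x.2) := by ext <;> simp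
    rwa [hx'] at h
  · have h := K.mul_mem h₁ h₂
    simpa using h

theorem isCoatom_stabilizer_perm_fin_four :
    IsCoatom (MulAction.stabilizer (Equiv.Perm (Fin 4)) (0 : Fin 4)) :=
  MulAction.IsPreprimitive.isCoatom_stabilizer_of_isPreprimitive _ _

theorem normalizer_stabilizer_perm_fin_four :
    Subgroup.normalizer (MulAction.stabilizer (Equiv.Perm (Fin 4)) (0 : Fin 4) :
      Set (Equiv.Perm (Fin 4))) = MulAction.stabilizer (Equiv.Perm (Fin 4)) (0 : Fin 4) := by
  refine le_antisymm (fun g hg => ?_) Subgroup.le_normalizer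
  have key : ∀ g : Equiv.Perm (Fin 4), (∀ t : Equiv.Perm (Fin 4), t 0 = 0 → (g * t * g⁻¹) 0 = 0) →
      g 0 = 0 := by decide
  exact key g fun t ht => (Subgroup.mem_normalizer_iff.1 hg t).1 ht

/-- **Group-theoretic core of Lemma A.4.**
In `G = S₄ × ℤ/2ℤ`, the subgroup `H = Stab(0) × 1` (a copy of `S₃`) is contained in
exactly four subgroups of `G` (namely `S₃×1`, `S₄×1`, `S₃×ℤ/2ℤ`, and `G`). -/
theorem stmt_13 :
    {K : Subgroup (Equiv.Perm (Fin 4) × Multiplicative (ZMod 2)) |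
        (MulAction.stabilizer (Equiv.Perm (Fin 4)) (0 : Fin 4)).prod ⊥ ≤ K}.ncard = 4 := by
  have : IsSimpleGroup (Multiplicative (ZMod 2)) :=
    isSimpleGroup_of_prime_card (p := 2) (by simp)
  have hS := isCoatom_stabilizer_perm_fin_four
  have hN := normalizer_stabilizer_perm_fin_four
  set S := MulAction.stabilizer (Equiv.Perm (Fin 4)) (0 : Fin 4)
  have hinj : Function.Injective fun p : Subgroup (Equiv.Perm (Fin 4)) ×
      Subgroup (Multiplicative (ZMod 2)) => p.1.prod p.2 := by
    rintro ⟨A, B⟩ ⟨A', B'⟩ h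
    ext x
    · simpa [Subgroup.mem_prod, one_mem] using SetLike.ext_iff.1 h (x, 1)
    · simpa [Subgroup.mem_prod, one_mem] using SetLike.ext_iff.1 h (1, x)
  have hset : {K : Subgroup (Equiv.Perm (Fin 4) × Multiplicative (ZMod 2)) | S.prod ⊥ ≤ K} =
      (fun p : Subgroup (Equiv.Perm (Fin 4)) × Subgroup (Multiplicative (ZMod 2)) =>
        p.1.prod p.2) '' ({S, ⊤} ×ˢ {⊥, ⊤}) := by
    ext K
    constructor
    · intro hK
      obtain ⟨A, B, hA, hB, rfl⟩ := Subgroup.eq_prod_of_prod_bot_le hS hN hK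
      exact ⟨(A, B), ⟨hA, hB⟩, rfl⟩
    · rintro ⟨⟨A, B⟩, ⟨hA, -⟩, rfl⟩
      have hSA : S ≤ A := by
        rcases hA with rfl | rfl
        exacts [le_rfl, le_top]
      exact Subgroup.prod_mono hSA bot_le
  rw [hset, Set.ncard_image_of_injective _ hinj, Set.ncard_prod, Set.ncard_pair hS.1,
    Set.ncard_pair bot_ne_top]
end
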